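/- arXiv:2407.12048 — 6 statements merged into one kernel-verified Lean document; each statement's English description precedes it below -/
import Mathlib

section
/- Let p > 1 be real and set σ_p = (2ᵖ − 1)^{1/p}. Let Λ_p⁽⁰⁾ be the lattice in ℝ² spanned over ℤ by the vectors (1, 0) and (1/2, σ_p/2). Then: (i) Λ_p⁽⁰⁾ is admissible for D_p, i.e. every nonzero (x,y) ∈ Λ_p⁽⁰⁾ satisfies |x|ᵖ + |y|ᵖ ≥ 1; (ii) the covolume of Λ_p⁽⁰⁾ equals σ_p/2; (iii) the points of Λ_p⁽⁰⁾ lying on the boundary curve |x|ᵖ + |y|ᵖ = 1 are exactly the three pairs ±(1,0), ±(1/2, σ_p/2), ±(−1/2, σ_p/2). -/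
/-- Dichotomy for lattice points: zero, strictly outside, or one of the six listed points. -/
theorem key_aux (p : ℝ) (hp : 1 < p) (σ : ℝ) (hs0 : 0 < σ) (hs : σ ^ p = (2 : ℝ) ^ p - 1)
    (m k : ℤ) : (m = 0 ∧ k = 0) ∨ 1 < |(m : ℝ) + k * (1 / 2)| ^ p + |(k : ℝ) * (σ / 2)| ^ p ∨
    (m = 1 ∧ k = 0) ∨ (m = -1 ∧ k = 0) ∨ (m = 0 ∧ k = 1) ∨ (m = 0 ∧ k = -1) ∨
      (m = -1 ∧ k = 1) ∨ (m = 1 ∧ k = -1) := by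
  have hp0 : 0 < p := by linarith
  have h2 : (2 : ℝ) < 2 ^ p := by
    simpa using Real.rpow_lt_rpow_of_exponent_lt (by norm_num : (1 : ℝ) < 2) hp
  have hk : |(k : ℝ) * (σ / 2)| ^ p = |(k : ℝ)| ^ p * ((2 ^ p - 1) / 2 ^ p) := by
    rw [abs_mul, abs_of_pos (by linarith : 0 < σ / 2),
      Real.mul_rpow (abs_nonneg _) (by linarith), Real.div_rpow hs0.le (by norm_num), hs]
  rw [hk]
  have hx : 0 ≤ |(m : ℝ) + k * (1 / 2)| ^ p := by positivity
  rcases lt_or_ge |k| 2 with h | h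
  · have hk3 : k = 0 ∨ k = 1 ∨ k = -1 := by
      rw [abs_lt] at h; omega
    have half : (1 / 2 : ℝ) ^ p + (2 ^ p - 1) / 2 ^ p = 1 := by
      rw [Real.div_rpow (by norm_num) (by norm_num), Real.one_rpow]
      field_simp
      ring
    rcases hk3 with rfl | rfl | rfl
    · by_cases hm : m = 0 ∨ m = 1 ∨ m = -1
      · omega
      · right; left
        have : (1 : ℤ) < |m| := by rw [lt_abs]; omega
        have h1 : (1 : ℝ) < |(m : ℝ)| := by exact_mod_cast this
        have := Real.one_lt_rpow h1 hp0
        simpa [Real.zero_rpow hp0.ne'] using this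
    · by_cases hm : m = 0 ∨ m = -1
      · omega
      · right; left
        have h1 : (1 / 2 : ℝ) < |(m : ℝ) + (1 : ℤ) * (1 / 2)| := by
          rw [lt_abs]
          rcases (by omega : 1 ≤ m ∨ m ≤ -2) with h | h
          · left; have : (1 : ℝ) ≤ m := by exact_mod_cast h
            push_cast; linarith
          · right; have : (m : ℝ) ≤ -2 := by exact_mod_cast h
            push_cast; linarith
        have := Real.rpow_lt_rpow (by norm_num) h1 hp0
        have e : |((1 : ℤ) : ℝ)| ^ p = 1 := by simp
        rw [e]; linarith
    · by_cases hm : m = 0 ∨ m = 1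
      · omega
      · right; left
        have h1 : (1 / 2 : ℝ) < |(m : ℝ) + (-1 : ℤ) * (1 / 2)| := by
          rw [lt_abs]
          rcases (by omega : 2 ≤ m ∨ m ≤ -1) with h | h
          · left; have : (2 : ℝ) ≤ m := by exact_mod_cast h
            push_cast; linarith
          · right; have : (m : ℝ) ≤ -1 := by exact_mod_cast h
            push_cast; linarith
        have := Real.rpow_lt_rpow (by norm_num) h1 hp0
        have e : |((-1 : ℤ) : ℝ)| ^ p = 1 := by simp
        rw [e]; linarith
  · right; left
    have h1 : (2 : ℝ) ≤ |(k : ℝ)| := by exact_mod_cast h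
    have h3 := Real.rpow_le_rpow (by norm_num) h1 hp0.le
    have h4 : 0 ≤ ((2 : ℝ) ^ p - 1) / 2 ^ p := div_nonneg (by linarith) (by linarith)
    have h5 := mul_le_mul_of_nonneg_right h3 h4
    have h6 : (2 : ℝ) ^ p * ((2 ^ p - 1) / 2 ^ p) = 2 ^ p - 1 := by field_simp
    linarith


/-- For real `p > 1` and `σ_p = (2ᵖ - 1)^(1/p)`, the lattice
`Λ_p⁽⁰⁾` spanned over `ℤ` by `(1,0)` and `(1/2, σ_p/2)` is admissible for `D_p`,
has covolume `σ_p/2`, and meets the curve `|x|ᵖ + |y|ᵖ = 1` exactly in the three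
pairs of points `±(1,0)`, `±(1/2, σ_p/2)`, `±(-1/2, σ_p/2)`. -/
theorem statement_3 (p : ℝ) (hp : 1 < p) (σ : ℝ) (hσ : σ = ((2 : ℝ) ^ p - 1) ^ (1 / p))
    (Λ : Set (ℝ × ℝ))
    (hΛ : Λ = {z : ℝ × ℝ | ∃ m k : ℤ, z = m • ((1 : ℝ), (0 : ℝ)) + k • ((1 / 2 : ℝ), σ / 2)}) :
    (∀ z ∈ Λ, z ≠ 0 → 1 ≤ |z.1| ^ p + |z.2| ^ p)
    ∧ |(1 : ℝ) * (σ / 2) - 0 * (1 / 2)| = σ / 2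
    ∧ {z : ℝ × ℝ | z ∈ Λ ∧ |z.1| ^ p + |z.2| ^ p = 1}
        = {((1 : ℝ), (0 : ℝ)), (-1, 0), (1 / 2, σ / 2), (-(1 / 2), -(σ / 2)),
            (-(1 / 2), σ / 2), (1 / 2, -(σ / 2))} := by
  have hp0 : 0 < p := by linarith
  have h2 : (2 : ℝ) < 2 ^ p := by
    simpa using Real.rpow_lt_rpow_of_exponent_lt (by norm_num : (1 : ℝ) < 2) hp
  have hs0 : 0 < σ := by rw [hσ]; exact Real.rpow_pos_of_pos (by linarith) _
  have hs : σ ^ p = (2 : ℝ) ^ p - 1 := by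
    rw [hσ, ← Real.rpow_mul (by linarith), one_div_mul_cancel hp0.ne', Real.rpow_one]
  have half : (1 / 2 : ℝ) ^ p + (σ / 2) ^ p = 1 := by
    rw [Real.div_rpow (by norm_num) (by norm_num), Real.div_rpow hs0.le (by norm_num), hs,
      Real.one_rpow]
    field_simp
    ring
  have ha : |σ / 2| = σ / 2 := abs_of_pos (by linarith)
  have hb : |(1 / 2 : ℝ)| = 1 / 2 := abs_of_pos (by norm_num)
  -- the six points are on the curve
  have six : ∀ z ∈ ({((1 : ℝ), (0 : ℝ)), (-1, 0), (1 / 2, σ / 2), (-(1 / 2), -(σ / 2)),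
            (-(1 / 2), σ / 2), (1 / 2, -(σ / 2))} : Set (ℝ × ℝ)),
      z ∈ Λ ∧ |z.1| ^ p + |z.2| ^ p = 1 := by
    intro z hz
    simp only [Set.mem_insert_iff, Set.mem_singleton_iff] at hz
    rw [hΛ]
    rcases hz with rfl | rfl | rfl | rfl | rfl | rfl
    · exact ⟨⟨1, 0, by simp⟩, by simp [Real.zero_rpow hp0.ne']⟩
    · exact ⟨⟨-1, 0, by simp⟩, by simp [Real.zero_rpow hp0.ne']⟩
    · exact ⟨⟨0, 1, by simp⟩, by simp only [abs_neg, ha, hb, half]⟩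
    · exact ⟨⟨0, -1, by simp⟩, by simp only [abs_neg, ha, hb, half]⟩
    · exact ⟨⟨-1, 1, by ext <;> norm_num⟩, by simp only [abs_neg, ha, hb, half]⟩
    · exact ⟨⟨1, -1, by ext <;> norm_num⟩, by simp only [abs_neg, ha, hb, half]⟩
  have tri : ∀ z ∈ Λ, z = 0 ∨ 1 < |z.1| ^ p + |z.2| ^ p ∨
      z ∈ ({((1 : ℝ), (0 : ℝ)), (-1, 0), (1 / 2, σ / 2), (-(1 / 2), -(σ / 2)),
            (-(1 / 2), σ / 2), (1 / 2, -(σ / 2))} : Set (ℝ × ℝ)) := by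
    intro z hz
    rw [hΛ] at hz
    obtain ⟨m, k, rfl⟩ := hz
    simp only [Set.mem_insert_iff, Set.mem_singleton_iff]
    rcases key_aux p hp σ hs0 hs m k with ⟨rfl, rfl⟩ | h | ⟨rfl, rfl⟩ | ⟨rfl, rfl⟩ | ⟨rfl, rfl⟩ |
      ⟨rfl, rfl⟩ | ⟨rfl, rfl⟩ | ⟨rfl, rfl⟩
    · left; simp
    · right; left; simpa using h
    · right; right; left; simp
    · right; right; right; left; simp
    · right; right; right; right; left; simp
    · right; right; right; right; right; left; simp
    · right; right; right; right; right; right; left; ext <;> norm_num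
    · right; right; right; right; right; right; right; ext <;> norm_num
  refine ⟨?_, ?_, ?_⟩
  · intro z hz h0
    rcases tri z hz with h | h | h
    · exact absurd h h0
    · exact h.le
    · exact (six z h).2.ge
  · rw [show (1 : ℝ) * (σ / 2) - 0 * (1 / 2) = σ / 2 by ring, ha]
  · ext z
    refine ⟨?_, six z⟩
    rintro ⟨hz, h1⟩
    rcases tri z hz with h | h | h
    · subst h
      simp [Real.zero_rpow hp0.ne'] at h1
    · exact absurd h1 h.ne'
    · exact h
end

section
/- Let Λ₂⁽¹⁾ be the lattice in ℝ² spanned over ℤ by the vectors (−√2/2, √2/2) and ((√6 − √2)/4, (√6 + √2)/4). Then: (i) Λ₂⁽¹⁾ is admissible for the open unit disc, i.e. every nonzero (x,y) ∈ Λ₂⁽¹⁾ satisfies x² + y² ≥ 1; (ii) the covolume of Λ₂⁽¹⁾ equals √3/2; (iii) Λ₂⁽¹⁾ contains the six points (−√2/2, √2/2), (√2/2, −√2/2), ±((√6 + √2)/4, (√6 − √2)/4), ±((√6 − √2)/4, (√6 + √2)/4), all of which lie on the unit circle x² + y² = 1. -/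
/-- The lattice `Λ₂⁽¹⁾` spanned over `ℤ` by `(-√2/2, √2/2)` and
`((√6 - √2)/4, (√6 + √2)/4)` is admissible for the open unit disc, has covolume
`√3/2`, and contains the six points `(-√2/2, √2/2)`, `(√2/2, -√2/2)`,
`±((√6 + √2)/4, (√6 - √2)/4)`, `±((√6 - √2)/4, (√6 + √2)/4)`, all lying on the
unit circle. -/
theorem statement_4 (u v : ℝ × ℝ)
    (hu : u = (-(Real.sqrt 2 / 2), Real.sqrt 2 / 2))
    (hv : v = ((Real.sqrt 6 - Real.sqrt 2) / 4, (Real.sqrt 6 + Real.sqrt 2) / 4))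
    (Λ : Set (ℝ × ℝ)) (hΛ : Λ = {z : ℝ × ℝ | ∃ m k : ℤ, z = m • u + k • v}) :
    (∀ z ∈ Λ, z ≠ 0 → 1 ≤ z.1 ^ 2 + z.2 ^ 2)
    ∧ |u.1 * v.2 - u.2 * v.1| = Real.sqrt 3 / 2
    ∧ (∀ z ∈ ({(-(Real.sqrt 2 / 2), Real.sqrt 2 / 2), (Real.sqrt 2 / 2, -(Real.sqrt 2 / 2)),
          ((Real.sqrt 6 + Real.sqrt 2) / 4, (Real.sqrt 6 - Real.sqrt 2) / 4),
          (-((Real.sqrt 6 + Real.sqrt 2) / 4), -((Real.sqrt 6 - Real.sqrt 2) / 4)),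
          ((Real.sqrt 6 - Real.sqrt 2) / 4, (Real.sqrt 6 + Real.sqrt 2) / 4),
          (-((Real.sqrt 6 - Real.sqrt 2) / 4), -((Real.sqrt 6 + Real.sqrt 2) / 4))} :
            Set (ℝ × ℝ)),
        z ∈ Λ ∧ z.1 ^ 2 + z.2 ^ 2 = 1) := by
  have h2 : Real.sqrt 2 ^ 2 = 2 := Real.sq_sqrt (by norm_num)
  have h3 : Real.sqrt 3 ^ 2 = 3 := Real.sq_sqrt (by norm_num)
  have h6 : Real.sqrt 6 = Real.sqrt 2 * Real.sqrt 3 := by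
    rw [← Real.sqrt_mul (by norm_num)]; norm_num
  have ht : 0 ≤ Real.sqrt 3 := Real.sqrt_nonneg 3
  rw [h6]
  rw [h6] at hv
  generalize Real.sqrt 2 = s at *
  generalize Real.sqrt 3 = t at *
  subst hu hv hΛ
  refine ⟨?_, ?_, ?_⟩
  · rintro z ⟨m, k, rfl⟩ hz
    have hpos : 1 ≤ m ^ 2 + m * k + k ^ 2 := by
      by_contra hlt
      have hk : k = 0 := by
        have : k ^ 2 ≤ 0 := by nlinarith [sq_nonneg (2 * m + k)]
        exact pow_eq_zero_iff two_ne_zero |>.mp (le_antisymm this (sq_nonneg k))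
      have hm : m = 0 := by
        have : m ^ 2 ≤ 0 := by subst hk; nlinarith
        exact pow_eq_zero_iff two_ne_zero |>.mp (le_antisymm this (sq_nonneg m))
      exact hz (by simp [hk, hm])
    have hpos' : (1 : ℝ) ≤ (m : ℝ) ^ 2 + m * k + (k : ℝ) ^ 2 := by exact_mod_cast hpos
    simp only [Prod.smul_mk, Prod.mk_add_mk, zsmul_eq_mul]
    refine hpos'.trans (le_of_eq ?_)
    linear_combination (-(m : ℝ) ^ 2 / 2 - m * k / 2 - k ^ 2 / 8 - k ^ 2 * t ^ 2 / 8) * h2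
      - (k : ℝ) ^ 2 / 4 * h3
  · have : -(s / 2) * ((s * t + s) / 4) - s / 2 * ((s * t - s) / 4) = -(t / 2) := by
      linear_combination (-t / 4) * h2
    simp only [this, abs_neg]
    exact abs_of_nonneg (by positivity)
  · intro z hz
    simp only [Set.mem_insert_iff, Set.mem_singleton_iff] at hz
    rcases hz with rfl | rfl | rfl | rfl | rfl | rfl
    · refine ⟨⟨1, 0, by simp⟩, ?_⟩
      linear_combination h2 / 2
    · refine ⟨⟨-1, 0, by simp⟩, ?_⟩
      linear_combination h2 / 2
    · refine ⟨⟨-1, 1, by ext <;> simp <;> ring⟩, ?_⟩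
      linear_combination (1 + t ^ 2) / 8 * h2 + h3 / 4
    · refine ⟨⟨1, -1, by ext <;> simp <;> ring⟩, ?_⟩
      linear_combination (1 + t ^ 2) / 8 * h2 + h3 / 4
    · refine ⟨⟨0, 1, by simp⟩, ?_⟩
      linear_combination (1 + t ^ 2) / 8 * h2 + h3 / 4
    · refine ⟨⟨0, -1, by simp⟩, ?_⟩
      linear_combination (1 + t ^ 2) / 8 * h2 + h3 / 4
end

section
/- Let p > 1 be real and let Λ be a critical lattice of D_p, i.e. a lattice admissible for D_p whose covolume d(Λ) equals the critical determinant Δ(D_p). Let (P_x, P_y) ∈ Λ be a point on the boundary curve |x|ᵖ + |y|ᵖ = 1. Then every point (u, v) ∈ ℝ² satisfying |P_x·v − P_y·u| = d(Λ) and |u|ᵖ + |v|ᵖ = 1 belongs to Λ. Consequently, the set of points of Λ lying on the curve |x|ᵖ + |y|ᵖ = 1 contains at least 6 points. -/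
noncomputable section

/-- The lattice in `ℝ²` spanned over `ℤ` by `u` and `v`. -/
def latticeOf (u v : ℝ × ℝ) : Set (ℝ × ℝ) := {z | ∃ m k : ℤ, z = m • u + k • v}

/-- The covolume of the lattice with `ℤ`-basis `u`, `v`: the absolute value of
the determinant of the basis. -/
def covol (u v : ℝ × ℝ) : ℝ := |u.1 * v.2 - u.2 * v.1|

/-- The lattice with `ℤ`-basis `u`, `v` is admissible for the Minkowski ball
`D_p = {(x,y) | |x|ᵖ + |y|ᵖ < 1}`: it is a genuine (full-rank) lattice and no
nonzero point of it lies in `D_p`. -/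
def IsAdmissible (p : ℝ) (u v : ℝ × ℝ) : Prop :=
  covol u v ≠ 0 ∧ ∀ z ∈ latticeOf u v, z ≠ 0 → 1 ≤ |z.1| ^ p + |z.2| ^ p

/-- The critical determinant `Δ(D_p)`: the infimum of covolumes of lattices
admissible for `D_p`. -/
def criticalDet (p : ℝ) : ℝ :=
  sInf {d : ℝ | ∃ u v : ℝ × ℝ, IsAdmissible p u v ∧ d = covol u v}

/-- The gauge `|x|ᵖ + |y|ᵖ`. -/
def gg (p : ℝ) (z : ℝ × ℝ) : ℝ := |z.1| ^ p + |z.2| ^ p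

lemma abs_rpow_strict (p : ℝ) (hp : 1 < p) {x y a b : ℝ} (hxy : x ≠ y) (ha : 0 < a) (hb : 0 < b)
    (hab : a + b = 1) : |a * x + b * y| ^ p < a * |x| ^ p + b * |y| ^ p := by
  have h1 : |a * x + b * y| ≤ a * |x| + b * |y| := by
    calc |a * x + b * y| ≤ |a * x| + |b * y| := abs_add_le _ _
      _ = _ := by rw [abs_mul, abs_mul, abs_of_pos ha, abs_of_pos hb]
  by_cases h : |x| = |y|
  · rcases abs_eq_abs.1 h with h' | h'
    · exact absurd h' hxy
    · subst h'
      have hy : 0 < |y| := abs_pos.2 (by rintro rfl; simp at hxy)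
      have h2 : |a * -y + b * y| < |y| := by
        have : a * -y + b * y = (b - a) * y := by ring
        rw [this, abs_mul]
        have : |b - a| < 1 := by rw [abs_lt]; constructor <;> linarith
        nlinarith
      have := Real.rpow_lt_rpow (abs_nonneg _) h2 (by linarith : 0 < p)
      rw [abs_neg, ← add_mul, hab, one_mul]; exact this
  · have := (strictConvexOn_rpow hp).2 (abs_nonneg x) (abs_nonneg y) h ha hb hab
    simp only [smul_eq_mul] at this
    exact lt_of_le_of_lt (Real.rpow_le_rpow (abs_nonneg _) h1 (by linarith)) this

lemma abs_rpow_conv (p : ℝ) (hp : 1 < p) {a b : ℝ} (x y : ℝ) (ha : 0 < a) (hb : 0 < b)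
    (hab : a + b = 1) : |a * x + b * y| ^ p ≤ a * |x| ^ p + b * |y| ^ p := by
  by_cases h : x = y
  · subst h
    rw [← add_mul, ← add_mul, hab, one_mul, one_mul]
  · exact (abs_rpow_strict p hp h ha hb hab).le

lemma gg_conv (p : ℝ) (hp : 1 < p) {a b : ℝ} (x y : ℝ × ℝ) (ha : 0 < a) (hb : 0 < b)
    (hab : a + b = 1) : gg p (a • x + b • y) ≤ a * gg p x + b * gg p y := by
  have h1 := abs_rpow_conv p hp x.1 y.1 ha hb hab
  have h2 := abs_rpow_conv p hp x.2 y.2 ha hb hab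
  simp only [gg, Prod.fst_add, Prod.snd_add, Prod.smul_fst, Prod.smul_snd, smul_eq_mul]
  linarith

lemma gg_strict (p : ℝ) (hp : 1 < p) {x y : ℝ × ℝ} {a b : ℝ} (hxy : x ≠ y) (ha : 0 < a)
    (hb : 0 < b) (hab : a + b = 1) : gg p (a • x + b • y) < a * gg p x + b * gg p y := by
  have h1 := abs_rpow_conv p hp x.1 y.1 ha hb hab
  have h2 := abs_rpow_conv p hp x.2 y.2 ha hb hab
  simp only [gg, Prod.fst_add, Prod.snd_add, Prod.smul_fst, Prod.smul_snd, smul_eq_mul]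
  by_cases h : x.1 = y.1
  · have h3 := abs_rpow_strict p hp (fun h' => hxy (Prod.ext h h')) ha hb hab
    linarith
  · have h3 := abs_rpow_strict p hp h ha hb hab
    linarith

lemma gg_smul (p : ℝ) (c : ℝ) (x : ℝ × ℝ) : gg p (c • x) = |c| ^ p * gg p x := by
  simp only [gg, Prod.smul_fst, Prod.smul_snd, smul_eq_mul, abs_mul]
  rw [Real.mul_rpow (abs_nonneg _) (abs_nonneg _), Real.mul_rpow (abs_nonneg _) (abs_nonneg _)]
  ring

lemma gg_neg (p : ℝ) (x : ℝ × ℝ) : gg p (-x) = gg p x := by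
  simp [gg]

lemma gg_nonneg (p : ℝ) (x : ℝ × ℝ) : 0 ≤ gg p x := by
  unfold gg; positivity

lemma gg_cont (p : ℝ) (hp : 1 < p) : Continuous (gg p) := by
  unfold gg
  have : 0 ≤ p := by linarith
  exact ((continuous_fst.abs).rpow_const (fun _ => Or.inr this)).add
    ((continuous_snd.abs).rpow_const (fun _ => Or.inr this))

/-- Lattices generated by a boundary point and a row avoiding the ball are admissible. -/
lemma adm_of_row (p : ℝ) (hp : 1 < p) (P Q : ℝ × ℝ) (hP : gg p P = 1) (hD : covol P Q ≠ 0)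
    (hrow : ∀ n : ℤ, 1 ≤ gg p (Q + (n : ℝ) • P)) : IsAdmissible p P Q := by
  have key : ∀ (k : ℕ) (m : ℤ), 1 ≤ k → 1 ≤ gg p ((m : ℝ) • P + (k : ℝ) • Q) := by
    intro k m hk
    rcases Nat.lt_or_ge k 2 with h2 | h2
    · have : k = 1 := by omega
      subst this
      have := hrow m
      simpa [add_comm] using this
    · by_contra! hlt
      have hk' : (2 : ℝ) ≤ k := by exact_mod_cast h2
      have hk0 : (0 : ℝ) < k := by linarith
      set c : ℝ := 1 / k with hc
      have hc0 : 0 < c := by positivity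
      have hck : c * k = 1 := by rw [hc]; field_simp
      have hc2 : c ≤ 1 / 2 := by nlinarith
      -- an integer n with |n - m c| ≤ 1 - c
      set n : ℤ := round ((m : ℝ) * c) with hn
      have hnr : |(m : ℝ) * c - n| ≤ 1 / 2 := abs_sub_round _
      set a : ℝ := (n - m * c) / (1 - c) with ha
      have h1c : 0 < 1 - c := by linarith
      have haa : |a| ≤ 1 := by
        rw [ha, abs_div, abs_of_pos h1c, div_le_one h1c, abs_sub_comm]; linarith
      have hac : (1 - c) * a = n - m * c := by rw [ha]; field_simp
      have h := gg_conv p hp ((m : ℝ) • P + (k : ℝ) • Q) (a • P) hc0 h1c (by ring)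
      have e : c • ((m : ℝ) • P + (k : ℝ) • Q) + (1 - c) • (a • P) = Q + (n : ℝ) • P := by
        rw [smul_add, smul_smul, smul_smul, smul_smul, hck, hac]
        module
      rw [e, gg_smul, hP] at h
      have h3 : |a| ^ p ≤ 1 := Real.rpow_le_one (abs_nonneg _) haa (by linarith)
      have := hrow n
      nlinarith
  refine ⟨hD, ?_⟩
  rintro z ⟨m, k, rfl⟩ hz
  change 1 ≤ gg p _
  rw [← Int.cast_smul_eq_zsmul ℝ m P, ← Int.cast_smul_eq_zsmul ℝ k Q]
  rcases lt_trichotomy k 0 with h | h | h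
  · obtain ⟨j, hj⟩ := Int.eq_ofNat_of_zero_le (show 0 ≤ -k by omega)
    have := key j (-m) (by omega)
    have hkj : (k : ℝ) = -(j : ℝ) := by
      have : k = -(j : ℤ) := by omega
      rw [this]; push_cast; ring
    rw [← gg_neg, hkj]
    convert this using 2
    push_cast
    module
  · subst h
    have hm : m ≠ 0 := by rintro rfl; simp at hz
    have : (1 : ℝ) ≤ |(m : ℝ)| := by exact_mod_cast Int.one_le_abs hm
    simp only [Int.cast_zero, zero_smul, add_zero, gg_smul, hP, mul_one]
    exact Real.one_le_rpow this (by linarith)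
  · obtain ⟨j, hj⟩ := Int.eq_ofNat_of_zero_le h.le
    have := key j m (by omega)
    subst hj
    simpa using this

/-- For critical covolume, every row at that height meets the closed ball. -/
lemma row_meets (p : ℝ) (hp : 1 < p) (P Q : ℝ × ℝ) (hP : gg p P = 1)
    (hD : covol P Q ≠ 0) (hcrit : covol P Q = criticalDet p) :
    ∃ n : ℤ, gg p (Q + (n : ℝ) • P) ≤ 1 := by
  by_contra! hrow
  -- all small contractions
  have hev : ∀ᶠ c : ℝ in nhdsWithin 1 (Set.Iio 1), ∀ n ∈ Finset.Icc (-(⌈gg p Q + 2⌉)) (⌈gg p Q + 2⌉),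
      1 < gg p (c • Q + (n : ℝ) • P) := by
    rw [Filter.eventually_all_finset]
    intro n _
    have hc : Continuous (fun c : ℝ => gg p (c • Q + (n : ℝ) • P)) :=
      (gg_cont p hp).comp (by fun_prop)
    have h1 : 1 < (fun c : ℝ => gg p (c • Q + (n : ℝ) • P)) 1 := by simpa using hrow n
    exact (hc.continuousAt.eventually (lt_mem_nhds h1)).filter_mono nhdsWithin_le_nhds
  have hev2 : ∀ᶠ c : ℝ in nhdsWithin 1 (Set.Iio 1), 0 < c ∧ c < 1 := by
    have h1 : ∀ᶠ c : ℝ in nhdsWithin 1 (Set.Iio 1), 0 < c :=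
      (lt_mem_nhds (by norm_num : (0 : ℝ) < 1)).filter_mono nhdsWithin_le_nhds
    have h2 : ∀ᶠ c : ℝ in nhdsWithin 1 (Set.Iio 1), c < 1 := self_mem_nhdsWithin
    exact h1.and h2
  obtain ⟨c, hc, hc0, hc1⟩ := (hev.and hev2).exists
  have hcov : covol P (c • Q) = c * covol P Q := by
    simp only [covol, Prod.smul_fst, Prod.smul_snd, smul_eq_mul]
    rw [← abs_of_pos hc0, ← abs_mul, abs_of_pos hc0]
    congr 1; ring
  have hpos : 0 < covol P Q := lt_of_le_of_ne (abs_nonneg _) (Ne.symm hD)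
  have hadm : IsAdmissible p P (c • Q) := by
    apply adm_of_row p hp _ _ hP
    · rw [hcov]; positivity
    · intro n
      by_cases hn : n ∈ Finset.Icc (-(⌈gg p Q + 2⌉)) (⌈gg p Q + 2⌉)
      · exact (hc n hn).le
      · have hn' : ⌈gg p Q + 2⌉ < |n| := by
          by_contra! h
          rw [abs_le] at h
          exact hn (Finset.mem_Icc.2 h)
        have hn2 : gg p Q + 2 < |(n : ℝ)| := by
          have := Int.ceil_lt_add_one (gg p Q + 2)
          have h3 := Int.le_ceil (gg p Q + 2)
          have h4 : ((⌈gg p Q + 2⌉ : ℤ) : ℝ) < ((|n| : ℤ) : ℝ) := by exact_mod_cast hn'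
          push_cast at h4
          linarith
        have hQ0 := gg_nonneg p Q
        have h := gg_conv p hp (c • Q + (n : ℝ) • P) (-(c • Q)) (by norm_num : (0 : ℝ) < 1 / 2)
          (by norm_num : (0 : ℝ) < 1 / 2) (by norm_num)
        have e : (1 / 2 : ℝ) • (c • Q + (n : ℝ) • P) + (1 / 2 : ℝ) • (-(c • Q))
            = ((n : ℝ) / 2) • P := by module
        rw [e, gg_neg, gg_smul, gg_smul, hP] at h
        have h5 : |(n : ℝ) / 2| = |(n : ℝ)| / 2 := by rw [abs_div]; norm_num
        have h6 : |(n : ℝ) / 2| ≤ |(n : ℝ) / 2| ^ p := by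
          have := Real.rpow_le_rpow_of_exponent_le (x := |(n : ℝ) / 2|) (by rw [h5]; linarith) hp.le
          simpa using this
        have h7 : |c| ^ p ≤ 1 := Real.rpow_le_one (abs_nonneg _)
          (by rw [abs_of_pos hc0]; exact hc1.le) (by linarith)
        nlinarith
  have hle : criticalDet p ≤ covol P (c • Q) := by
    apply csInf_le
    · refine ⟨0, ?_⟩
      rintro d ⟨a, b, _, rfl⟩
      exact abs_nonneg _
    · exact ⟨_, _, hadm, rfl⟩
  rw [hcov, ← hcrit] at hle
  nlinarith

/-- Strict convexity along a line. -/
lemma line_strict (p : ℝ) (hp : 1 < p) (P Q : ℝ × ℝ) (hP0 : P ≠ 0) {r s t : ℝ} (hrs : r < s)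
    (hst : s < t) (hr : gg p (Q + r • P) ≤ 1) (ht : gg p (Q + t • P) ≤ 1) :
    gg p (Q + s • P) < 1 := by
  have hne : Q + r • P ≠ Q + t • P := by
    intro h
    have h2 : (t - r) • P = 0 := by
      rw [sub_smul, sub_eq_zero]; exact (add_left_cancel h).symm
    rcases smul_eq_zero.1 h2 with h3 | h3
    · linarith
    · exact hP0 h3
  have h0 : 0 < t - r := by linarith
  have ha : 0 < (t - s) / (t - r) := div_pos (by linarith) h0
  have hb : 0 < (s - r) / (t - r) := div_pos (by linarith) h0
  have hab : (t - s) / (t - r) + (s - r) / (t - r) = 1 := by field_simp; ring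
  have h := gg_strict p hp hne ha hb hab
  have hs : (t - s) / (t - r) * r + (s - r) / (t - r) * t = s := by field_simp; ring
  have e : ((t - s) / (t - r)) • (Q + r • P) + ((s - r) / (t - r)) • (Q + t • P) = Q + s • P := by
    rw [smul_add, smul_add, smul_smul, smul_smul]
    calc _ = ((t - s) / (t - r) + (s - r) / (t - r)) • Q
          + ((t - s) / (t - r) * r + (s - r) / (t - r) * t) • P := by module
      _ = _ := by rw [hab, hs, one_smul]
  rw [e] at h
  nlinarith

lemma covol_shift (P Q : ℝ × ℝ) (t : ℝ) : covol P (Q + t • P) = covol P Q := by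
  simp only [covol, Prod.fst_add, Prod.snd_add, Prod.smul_fst, Prod.smul_snd, smul_eq_mul]
  congr 1; ring

/-- If the chord starts at `Q` and reaches `Q + P/2`, it ends at `Q + P`. -/
lemma chord_end (p : ℝ) (hp : 1 < p) (P Q : ℝ × ℝ) (hP : gg p P = 1) (hP0 : P ≠ 0)
    (hD : covol P Q ≠ 0) (hcrit : covol P Q = criticalDet p)
    (h0 : gg p Q = 1) (hh : gg p (Q + (1 / 2 : ℝ) • P) ≤ 1) :
    gg p (Q + P) ≤ 1 := by
  by_contra! h1
  have h0' : gg p (Q + (0 : ℝ) • P) = 1 := by simpa using h0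
  have hc : Continuous (fun s : ℝ => gg p (Q + s • P)) := (gg_cont p hp).comp (by fun_prop)
  have hev : ∀ᶠ s : ℝ in nhdsWithin 1 (Set.Iio 1), 1 < gg p (Q + s • P) := by
    have h1' : 1 < (fun s : ℝ => gg p (Q + s • P)) 1 := by simpa using h1
    exact (hc.continuousAt.eventually (lt_mem_nhds h1')).filter_mono nhdsWithin_le_nhds
  have hev1 : ∀ᶠ s : ℝ in nhdsWithin 1 (Set.Iio 1), 1 / 2 < s :=
    (lt_mem_nhds (by norm_num : (1 / 2 : ℝ) < 1)).filter_mono nhdsWithin_le_nhds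
  have hev2 : ∀ᶠ s : ℝ in nhdsWithin 1 (Set.Iio 1), s < 1 := self_mem_nhdsWithin
  obtain ⟨s, ⟨hs, hs2⟩, hs1⟩ := ((hev.and hev1).and hev2).exists
  obtain ⟨n, hn⟩ := row_meets p hp P (Q + s • P) hP (by rwa [covol_shift])
    (by rwa [covol_shift])
  have e : Q + s • P + (n : ℝ) • P = Q + (s + n) • P := by module
  rw [e] at hn
  rcases lt_trichotomy n 0 with h | h | h
  · have : (n : ℝ) ≤ -1 := by exact_mod_cast (show n ≤ -1 by omega)
    have := line_strict p hp P Q hP0 (r := s + n) (s := 0) (t := 1 / 2) (by linarith)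
      (by norm_num) hn hh
    linarith
  · subst h
    simp only [Int.cast_zero, add_zero] at hn
    linarith
  · have : (1 : ℝ) ≤ n := by exact_mod_cast h
    have := line_strict p hp P Q hP0 (r := 1 / 2) (s := 1) (t := s + n) (by norm_num)
      (by linarith) hh hn
    rw [one_smul] at this
    linarith

/-- The chord at critical height has lattice endpoints. -/
lemma exists_chord (p : ℝ) (hp : 1 < p) (P Q : ℝ × ℝ) (hP : gg p P = 1) (hP0 : P ≠ 0)
    (hD : covol P Q ≠ 0) (hcrit : covol P Q = criticalDet p)
    (hrow : ∀ n : ℤ, 1 ≤ gg p (Q + (n : ℝ) • P)) :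
    ∃ n : ℤ, gg p (Q + (n : ℝ) • P) = 1 ∧ gg p (Q + ((n + 1 : ℤ) : ℝ) • P) = 1 := by
  obtain ⟨n, hn⟩ := row_meets p hp P Q hP hD hcrit
  have hn1 : gg p (Q + (n : ℝ) • P) = 1 := le_antisymm hn (hrow n)
  obtain ⟨k, hk⟩ := row_meets p hp P (Q + (1 / 2 : ℝ) • P) hP (by rwa [covol_shift])
    (by rwa [covol_shift])
  have e : Q + (1 / 2 : ℝ) • P + (k : ℝ) • P = Q + (1 / 2 + k : ℝ) • P := by module
  rw [e] at hk
  rcases lt_or_ge k n with h | h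
  · -- the half point is on the left
    have hkn : (k : ℝ) + 1 ≤ n := by exact_mod_cast h
    have hh : gg p (Q + (n - 1 / 2 : ℝ) • P) ≤ 1 := by
      rcases eq_or_lt_of_le hkn with h' | h'
      · have : (n - 1 / 2 : ℝ) = 1 / 2 + k := by linarith
        rw [this]; exact hk
      · exact (line_strict p hp P Q hP0 (by linarith) (by linarith) hk hn).le
    have hneg : covol (-P) (Q + (n : ℝ) • P) = covol P Q := by
      rw [← covol_shift P Q n]
      simp only [covol, Prod.fst_neg, Prod.snd_neg]
      rw [← abs_neg]; congr 1; ring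
    have := chord_end p hp (-P) (Q + (n : ℝ) • P) (by rw [gg_neg, hP]) (neg_ne_zero.2 hP0)
      (by rwa [hneg]) (by rwa [hneg]) hn1 (by convert hh using 2; module)
    refine ⟨n - 1, le_antisymm ?_ (hrow _), by simpa using hn1⟩
    refine le_of_eq_of_le (congrArg (gg p) ?_) this
    push_cast
    module
  · have hkn : (n : ℝ) ≤ k := by exact_mod_cast h
    have hh : gg p (Q + (n + 1 / 2 : ℝ) • P) ≤ 1 := by
      rcases eq_or_lt_of_le hkn with h' | h'
      · have : (n + 1 / 2 : ℝ) = 1 / 2 + k := by linarith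
        rw [this]; exact hk
      · exact (line_strict p hp P Q hP0 (by linarith) (by linarith) hn hk).le
    have := chord_end p hp P (Q + (n : ℝ) • P) hP hP0
      (by rwa [covol_shift]) (by rwa [covol_shift]) hn1 (by convert hh using 2; module)
    refine ⟨n, hn1, le_antisymm ?_ (hrow _)⟩
    refine le_of_eq_of_le (congrArg (gg p) ?_) this
    push_cast
    module

/-- Completing a boundary lattice point to a basis. -/
lemma exists_basis (p : ℝ) (hp : 1 < p) (u v : ℝ × ℝ) (hadm : IsAdmissible p u v)
    (P : ℝ × ℝ) (hP : P ∈ latticeOf u v) (hPc : gg p P = 1) (hP0 : P ≠ 0) :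
    ∃ Q ∈ latticeOf u v, covol P Q = covol u v := by
  obtain ⟨m, k, rfl⟩ := hP
  have hg0 : 0 < Int.gcd m k := by
    rw [Nat.pos_iff_ne_zero, Ne, Int.gcd_eq_zero_iff]
    rintro ⟨rfl, rfl⟩
    simp at hP0
  obtain ⟨m', hm'⟩ := Int.gcd_dvd_left m k
  obtain ⟨k', hk'⟩ := Int.gcd_dvd_right m k
  have hPP : m • u + k • v = ((Int.gcd m k : ℕ) : ℝ) • (m' • u + k' • v) := by
    have e1 : (m : ℝ) = ((Int.gcd m k : ℕ) : ℝ) * m' := by exact_mod_cast hm'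
    have e2 : (k : ℝ) = ((Int.gcd m k : ℕ) : ℝ) * k' := by exact_mod_cast hk'
    simp only [← Int.cast_smul_eq_zsmul ℝ]
    generalize ((Int.gcd m k : ℕ) : ℝ) = g at e1 e2 ⊢
    rw [e1, e2]
    module
  have hg1 : Int.gcd m k = 1 := by
    by_contra hne
    have h2 : (2 : ℝ) ≤ (Int.gcd m k : ℕ) := by exact_mod_cast (show 2 ≤ Int.gcd m k by omega)
    have h0 : m' • u + k' • v ≠ 0 := by
      intro h; rw [hPP, h, smul_zero] at hP0; exact hP0 rfl
    have h1 : 1 ≤ gg p (m' • u + k' • v) := hadm.2 _ ⟨m', k', rfl⟩ h0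
    rw [hPP, gg_smul] at hPc
    have h3 : (1 : ℝ) < |((Int.gcd m k : ℕ) : ℝ)| ^ p := by
      apply Real.one_lt_rpow _ (by linarith)
      rw [abs_of_pos (by linarith)]; linarith
    nlinarith
  have hb := Int.gcd_eq_gcd_ab m k
  rw [hg1] at hb
  refine ⟨(-(Int.gcdB m k)) • u + (Int.gcdA m k) • v, ⟨_, _, rfl⟩, ?_⟩
  have hb' : (1 : ℝ) = m * Int.gcdA m k + k * Int.gcdB m k := by exact_mod_cast hb
  simp only [covol, ← Int.cast_smul_eq_zsmul ℝ, Prod.fst_add, Prod.snd_add, Prod.smul_fst,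
    Prod.smul_snd, smul_eq_mul]
  congr 1
  push_cast
  linear_combination (-(u.1 * v.2 - u.2 * v.1)) * hb'

lemma lat_comb {u v x y : ℝ × ℝ} (hx : x ∈ latticeOf u v) (hy : y ∈ latticeOf u v) (n : ℤ) :
    x + (n : ℝ) • y ∈ latticeOf u v := by
  obtain ⟨a, b, rfl⟩ := hx
  obtain ⟨c, d, rfl⟩ := hy
  refine ⟨a + n * c, b + n * d, ?_⟩
  simp only [← Int.cast_smul_eq_zsmul ℝ]
  push_cast
  module

lemma lat_neg {u v x : ℝ × ℝ} (hx : x ∈ latticeOf u v) : -x ∈ latticeOf u v := by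
  obtain ⟨a, b, rfl⟩ := hx
  refine ⟨-a, -b, ?_⟩
  simp only [← Int.cast_smul_eq_zsmul ℝ]
  push_cast
  module

/-- If `Λ` is a critical lattice of `D_p` and `(P_x, P_y) ∈ Λ` lies
on the boundary curve, then every `(u,v)` with `|P_x·v - P_y·u| = d(Λ)` and
`|u|ᵖ + |v|ᵖ = 1` belongs to `Λ`; consequently `Λ` has at least `6` points on
the curve `|x|ᵖ + |y|ᵖ = 1`. -/
theorem statement_5 (p : ℝ) (hp : 1 < p) (u v : ℝ × ℝ)
    (hadm : IsAdmissible p u v) (hcrit : covol u v = criticalDet p)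
    (P : ℝ × ℝ) (hP : P ∈ latticeOf u v) (hPc : |P.1| ^ p + |P.2| ^ p = 1) :
    (∀ w : ℝ × ℝ, |P.1 * w.2 - P.2 * w.1| = covol u v → |w.1| ^ p + |w.2| ^ p = 1 →
        w ∈ latticeOf u v)
    ∧ ∃ S : Finset (ℝ × ℝ), S.card = 6 ∧
        ∀ z ∈ S, z ∈ latticeOf u v ∧ |z.1| ^ p + |z.2| ^ p = 1 := by
  change gg p P = 1 at hPc
  have hP0 : P ≠ 0 := by
    rintro rfl
    simp [gg, Real.zero_rpow (show p ≠ 0 by linarith)] at hPc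
  obtain ⟨Q₀, hQ₀, hcov₀⟩ := exists_basis p hp u v hadm P hP hPc hP0
  have hD₀ : covol P Q₀ ≠ 0 := by rw [hcov₀]; exact hadm.1
  have hrow₀ : ∀ n : ℤ, 1 ≤ gg p (Q₀ + (n : ℝ) • P) := by
    intro n
    apply hadm.2 _ (lat_comb hQ₀ hP n)
    intro h
    apply hD₀
    rw [← covol_shift P Q₀ n, h]
    simp [covol]
  obtain ⟨n, hn, hn1⟩ := exists_chord p hp P Q₀ hPc hP0 hD₀ (by rw [hcov₀, hcrit]) hrow₀
  obtain ⟨Q, hQdef⟩ : ∃ Q, Q = Q₀ + (n : ℝ) • P := ⟨_, rfl⟩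
  have hQ : Q ∈ latticeOf u v := by rw [hQdef]; exact lat_comb hQ₀ hP n
  have hcov : covol P Q = covol u v := by rw [hQdef, covol_shift, hcov₀]
  have hg0 : gg p Q = 1 := by rw [hQdef]; exact hn
  have hg1 : gg p (Q + P) = 1 := by
    rw [← hn1, hQdef]; congr 1; push_cast; module
  have hQP : Q + P ∈ latticeOf u v := by simpa using lat_comb hQ hP 1
  have hD : P.1 * Q.2 - P.2 * Q.1 ≠ 0 := by
    intro h
    apply hadm.1
    rw [← hcov, covol, h, abs_zero]
  constructor
  · -- the points on the line through `Q`
    have key : ∀ w : ℝ × ℝ, P.1 * w.2 - P.2 * w.1 = P.1 * Q.2 - P.2 * Q.1 → gg p w = 1 →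
        w ∈ latticeOf u v := by
      intro w hw hgw
      obtain ⟨s, hs⟩ : ∃ s : ℝ, w = Q + s • P := by
        obtain ⟨s, hs⟩ : ∃ s : ℝ, s * (P.1 * Q.2 - P.2 * Q.1) = w.1 * Q.2 - w.2 * Q.1 :=
          ⟨_, div_mul_cancel₀ _ hD⟩
        refine ⟨s, ?_⟩
        ext
        · simp only [Prod.fst_add, Prod.smul_fst, smul_eq_mul]
          apply mul_right_cancel₀ hD
          linear_combination Q.1 * hw - P.1 * hs
        · simp only [Prod.snd_add, Prod.smul_snd, smul_eq_mul]
          apply mul_right_cancel₀ hD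
          linear_combination Q.2 * hw - P.2 * hs
      have hg0' : gg p (Q + (0 : ℝ) • P) = 1 := by simpa using hg0
      have hg1' : gg p (Q + (1 : ℝ) • P) = 1 := by simpa using hg1
      have hgs : gg p (Q + s • P) = 1 := by rw [← hs]; exact hgw
      rcases lt_trichotomy s 0 with h | h | h
      · have := line_strict p hp P Q hP0 h one_pos hgs.le hg1'.le
        linarith
      · rw [hs, h, zero_smul, add_zero]; exact hQ
      · rcases lt_trichotomy s 1 with h' | h' | h'
        · have := line_strict p hp P Q hP0 h h' hg0'.le hg1'.le
          linarith
        · rw [hs, h', one_smul]; exact hQP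
        · have := line_strict p hp P Q hP0 one_pos h' hg0'.le hgs.le
          linarith
    intro w hw hgw
    rw [← hcov, covol] at hw
    rcases abs_eq_abs.1 hw with h | h
    · exact key w h hgw
    · have := key (-w) (by simp only [Prod.fst_neg, Prod.snd_neg]; linarith)
        (by rw [gg_neg]; exact hgw)
      simpa using lat_neg this
  · -- six points
    have inj : ∀ a b c d : ℝ, a • P + b • Q = c • P + d • Q → a = c ∧ b = d := by
      intro a b c d h
      have h1 := congrArg Prod.fst h
      have h2 := congrArg Prod.snd h
      simp only [Prod.fst_add, Prod.snd_add, Prod.smul_fst, Prod.smul_snd, smul_eq_mul] at h1 h2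
      constructor
      · apply mul_right_cancel₀ hD
        linear_combination Q.2 * h1 - Q.1 * h2
      · apply mul_right_cancel₀ hD
        linear_combination P.1 * h2 - P.2 * h1
    let F : ℝ × ℝ → ℝ × ℝ := fun c => c.1 • P + c.2 • Q
    have hF : Function.Injective F := by
      intro a b h
      exact Prod.ext_iff.2 (inj _ _ _ _ h)
    refine ⟨({(1, 0), (-1, 0), (0, 1), (0, -1), (1, 1), (-1, -1)} : Finset (ℝ × ℝ)).image F,
      ?_, ?_⟩
    · rw [Finset.card_image_of_injective _ hF]
      repeat rw [Finset.card_insert_of_notMem (by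
        simp only [Finset.mem_insert, Finset.mem_singleton, Prod.mk.injEq]; norm_num)]
      simp
    · intro z hz
      change z ∈ latticeOf u v ∧ gg p z = 1
      have hneg : ∀ z, z ∈ latticeOf u v ∧ gg p z = 1 → -z ∈ latticeOf u v ∧ gg p (-z) = 1 :=
        fun z h => ⟨lat_neg h.1, by rw [gg_neg]; exact h.2⟩
      rw [Finset.mem_image] at hz
      obtain ⟨c, hc, rfl⟩ := hz
      simp only [Finset.mem_insert, Finset.mem_singleton] at hc
      rcases hc with rfl | rfl | rfl | rfl | rfl | rfl
      · simpa [F] using (⟨hP, hPc⟩ : _ ∧ _)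
      · simpa [F] using hneg P ⟨hP, hPc⟩
      · simpa [F] using (⟨hQ, hg0⟩ : _ ∧ _)
      · simpa [F] using hneg Q ⟨hQ, hg0⟩
      · have : F (1, 1) = Q + P := by simp [F, add_comm]
        rw [this]; exact ⟨hQP, hg1⟩
      · have : F (-1, -1) = -(Q + P) := by simp [F]
        rw [this]; exact hneg _ ⟨hQP, hg1⟩

end
end

section
/- For any two vectors u = (u₁, u₂) and v = (v₁, v₂) in ℝ², the two-dimensional Lebesgue measure of the convex hull of the six points u, v, u + v, −u, −v, −(u + v) equals 3·|u₁v₂ − u₂v₁|. -/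
open MeasureTheory in
theorem hexBase_volume :
    volume {p : ℝ × ℝ | |p.1| ≤ 1 ∧ |p.2| ≤ 1 ∧ |p.1 - p.2| ≤ 1} = ENNReal.ofReal 3 := by
  have hm : MeasurableSet {p : ℝ × ℝ | |p.1| ≤ 1 ∧ |p.2| ≤ 1 ∧ |p.1 - p.2| ≤ 1} := by
    have c1 : IsClosed {p : ℝ × ℝ | |p.1| ≤ 1} := isClosed_le (by fun_prop) (by fun_prop)
    have c2 : IsClosed {p : ℝ × ℝ | |p.2| ≤ 1} := isClosed_le (by fun_prop) (by fun_prop)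
    have c3 : IsClosed {p : ℝ × ℝ | |p.1 - p.2| ≤ 1} := isClosed_le (by fun_prop) (by fun_prop)
    exact (c1.inter (c2.inter c3)).measurableSet
  rw [Measure.volume_eq_prod, Measure.prod_apply hm]
  have hs : ∀ x : ℝ, volume (Prod.mk x ⁻¹' {p : ℝ × ℝ | |p.1| ≤ 1 ∧ |p.2| ≤ 1 ∧ |p.1 - p.2| ≤ 1})
      = (Set.Icc (-1 : ℝ) 1).indicator (fun x => ENNReal.ofReal (2 - |x|)) x := by
    intro x
    by_cases hx : x ∈ Set.Icc (-1 : ℝ) 1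
    · rw [Set.indicator_of_mem hx]
      obtain ⟨h1, h2⟩ := hx
      have : Prod.mk x ⁻¹' {p : ℝ × ℝ | |p.1| ≤ 1 ∧ |p.2| ≤ 1 ∧ |p.1 - p.2| ≤ 1}
          = Set.Icc (max (-1) (x - 1)) (min 1 (x + 1)) := by
        ext y
        simp only [Set.mem_preimage, Set.mem_ofPred_eq, Set.mem_Icc, abs_le, max_le_iff, le_min_iff]
        constructor
        · rintro ⟨_, ⟨_, _⟩, _, _⟩
          refine ⟨⟨?_, ?_⟩, ?_, ?_⟩ <;> linarith
        · rintro ⟨⟨_, _⟩, _, _⟩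
          refine ⟨⟨?_, ?_⟩, ⟨?_, ?_⟩, ?_, ?_⟩ <;> linarith
      rw [this, Real.volume_Icc]
      congr 1
      rcases le_total 0 x with h | h
      · rw [abs_of_nonneg h, max_eq_right (by linarith), min_eq_left (by linarith)]; ring
      · rw [abs_of_nonpos h, max_eq_left (by linarith), min_eq_right (by linarith)]; ring
    · rw [Set.indicator_of_notMem hx]
      have : Prod.mk x ⁻¹' {p : ℝ × ℝ | |p.1| ≤ 1 ∧ |p.2| ≤ 1 ∧ |p.1 - p.2| ≤ 1} = ∅ := by
        ext y
        simp only [Set.mem_preimage, Set.mem_ofPred_eq, Set.mem_empty_iff_false, iff_false]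
        rintro ⟨h, _⟩
        exact hx (abs_le.1 h)
      rw [this, measure_empty]
  simp_rw [hs]
  rw [lintegral_indicator measurableSet_Icc, ← ofReal_integral_eq_lintegral_ofReal]
  · congr 1
    rw [integral_Icc_eq_integral_Ioc, ← intervalIntegral.integral_of_le (by norm_num)]
    rw [← intervalIntegral.integral_add_adjacent_intervals (b := 0)
      (Continuous.intervalIntegrable (by fun_prop) _ _)
      (Continuous.intervalIntegrable (by fun_prop) _ _)]
    have e1 : ∫ x in (-1 : ℝ)..0, (2 - |x|) = ∫ x in (-1 : ℝ)..0, (2 + x) := by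
      apply intervalIntegral.integral_congr
      intro x hx
      rw [Set.uIcc_of_le (by norm_num)] at hx
      simp only [abs_of_nonpos hx.2]; ring
    have e2 : ∫ x in (0 : ℝ)..1, (2 - |x|) = ∫ x in (0 : ℝ)..1, (2 - x) := by
      apply intervalIntegral.integral_congr
      intro x hx
      rw [Set.uIcc_of_le (by norm_num)] at hx
      simp only [abs_of_nonneg hx.1]
    rw [e1, e2, intervalIntegral.integral_add (by simp) (by simp),
      intervalIntegral.integral_sub (by simp) (by simp)]
    simp
    norm_num
  · exact (Continuous.continuousOn (by fun_prop)).integrableOn_Icc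
  · filter_upwards [ae_restrict_mem measurableSet_Icc] with x hx
    have := abs_le.2 hx
    simp only [Pi.zero_apply]; linarith

theorem hexBase_eq :
    convexHull ℝ ({(1, 0), (0, 1), (1, 1), (-1, 0), (0, -1), (-1, -1)} : Set (ℝ × ℝ))
      = {p : ℝ × ℝ | |p.1| ≤ 1 ∧ |p.2| ≤ 1 ∧ |p.1 - p.2| ≤ 1} := by
  apply Set.Subset.antisymm
  · apply convexHull_min
    · intro p hp
      simp only [Set.mem_insert_iff, Set.mem_singleton_iff] at hp
      rcases hp with rfl | rfl | rfl | rfl | rfl | rfl <;> norm_num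
    · intro p hp q hq a b ha hb hab
      simp only [Set.mem_ofPred_eq, abs_le, Prod.fst_add, Prod.snd_add, Prod.smul_fst,
        Prod.smul_snd, smul_eq_mul] at *
      obtain ⟨⟨_, _⟩, ⟨_, _⟩, _, _⟩ := hp
      obtain ⟨⟨_, _⟩, ⟨_, _⟩, _, _⟩ := hq
      refine ⟨⟨?_, ?_⟩, ⟨?_, ?_⟩, ?_, ?_⟩ <;> nlinarith
  · rintro ⟨x, y⟩ ⟨h1, h2, h3⟩
    simp only [abs_le] at h1 h2 h3
    obtain ⟨_, _⟩ := h1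
    obtain ⟨_, _⟩ := h2
    obtain ⟨_, _⟩ := h3
    set S : Set (ℝ × ℝ) := {(1, 0), (0, 1), (1, 1), (-1, 0), (0, -1), (-1, -1)} with hS
    have hc : Convex ℝ (convexHull ℝ S) := convex_convexHull ℝ S
    have m : ∀ p ∈ S, p ∈ convexHull ℝ S := fun p hp => subset_convexHull ℝ S hp
    have m1 := m (1, 0) (by simp [hS])
    have m2 := m (0, 1) (by simp [hS])
    have m3 := m (1, 1) (by simp [hS])
    have m4 := m (-1, 0) (by simp [hS])
    have m5 := m (0, -1) (by simp [hS])
    have m6 := m (-1, -1) (by simp [hS])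
    have m0 : (0 : ℝ × ℝ) ∈ convexHull ℝ S := by
      have := hc m1 m4 (a := 1/2) (b := 1/2) (by norm_num) (by norm_num) (by norm_num)
      simpa [← Prod.zero_eq_mk] using this
    have key : ∀ p ∈ convexHull ℝ S, ∀ q ∈ convexHull ℝ S, ∀ a b : ℝ, 0 ≤ a → 0 ≤ b → a + b ≤ 1 →
        (x, y) = a • p + b • q → (x, y) ∈ convexHull ℝ S := by
      intro p hp q hq a b ha hb hab h
      rw [h]
      rcases eq_or_lt_of_le (add_nonneg ha hb) with h0 | h0
      · have ha0 : a = 0 := by linarith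
        have hb0 : b = 0 := by linarith
        rw [ha0, hb0, zero_smul, zero_smul, add_zero]
        exact m0
      · have h4 := hc hp hq (a := a / (a + b)) (b := b / (a + b)) (by positivity) (by positivity)
          (by field_simp)
        have h5 := hc h4 m0 (a := a + b) (b := 1 - (a + b)) h0.le (by linarith) (by ring)
        rw [smul_zero, add_zero, smul_add, smul_smul, smul_smul, mul_div_cancel₀ _ h0.ne',
          mul_div_cancel₀ _ h0.ne'] at h5
        exact h5
    rcases le_total 0 x with hx | hx <;> rcases le_total 0 y with hy | hy
    · rcases le_total x y with hxy | hxy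
      · exact key _ m3 _ m2 x (y - x) hx (by linarith) (by linarith) (by ext <;> simp)
      · exact key _ m3 _ m1 y (x - y) hy (by linarith) (by linarith) (by ext <;> simp)
    · exact key _ m1 _ m5 x (-y) hx (by linarith) (by linarith) (by ext <;> simp)
    · exact key _ m4 _ m2 (-x) y (by linarith) hy (by linarith) (by ext <;> simp)
    · rcases le_total x y with hxy | hxy
      · exact key _ m6 _ m4 (-y) (y - x) (by linarith) (by linarith) (by linarith)
          (by ext <;> simp)
      · exact key _ m6 _ m5 (-x) (x - y) (by linarith) (by linarith) (by linarith)
          (by ext <;> simp)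

/-- For any `u, v ∈ ℝ²`, the area of the hexagon
`conv{u, v, u+v, -u, -v, -(u+v)}` equals `3·|u₁v₂ - u₂v₁|`. -/
theorem statement_6 (u v : ℝ × ℝ) :
    MeasureTheory.volume (convexHull ℝ ({u, v, u + v, -u, -v, -(u + v)} : Set (ℝ × ℝ)))
      = ENNReal.ofReal (3 * |u.1 * v.2 - u.2 * v.1|) := by
  let L : ℝ × ℝ →ₗ[ℝ] ℝ × ℝ :=
    (LinearMap.fst ℝ ℝ ℝ).smulRight u + (LinearMap.snd ℝ ℝ ℝ).smulRight v
  have hL : ∀ p : ℝ × ℝ, L p = p.1 • u + p.2 • v := fun p => rfl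
  have himg : ({u, v, u + v, -u, -v, -(u + v)} : Set (ℝ × ℝ))
      = L '' {(1, 0), (0, 1), (1, 1), (-1, 0), (0, -1), (-1, -1)} := by
    simp only [Set.image_insert_eq, Set.image_singleton, hL]
    simp [add_comm]
  have hdet : LinearMap.det L = u.1 * v.2 - u.2 * v.1 := by
    rw [← LinearMap.det_toMatrix (Module.Basis.finTwoProd ℝ), Matrix.det_fin_two]
    simp [LinearMap.toMatrix_apply, hL]
    ring
  rw [himg, ← L.image_convexHull, hexBase_eq, MeasureTheory.Measure.addHaar_image_linearMap,
    hexBase_volume, hdet, ← ENNReal.ofReal_mul (abs_nonneg _), mul_comm]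
end

section
/- Let p > 1 be real and let τ ≥ 0, σ ≥ 0. Set u = ((1 + τᵖ)^{−1/p}, τ·(1 + τᵖ)^{−1/p}) and v = (−(1 + σᵖ)^{−1/p}, σ·(1 + σᵖ)^{−1/p}); both u and v lie on the curve |x|ᵖ + |y|ᵖ = 1. Then the area of the hexagon conv{±u, ±v, ±(u + v)} equals A(σ, p) = 3·(τ + σ)·(1 + τᵖ)^{−1/p}·(1 + σᵖ)^{−1/p}. -/
/-- The standard hexagon. -/
def stdHex : Set (ℝ × ℝ) :=
  {x | -1 ≤ x.1 ∧ x.1 ≤ 1 ∧ -1 ≤ x.2 ∧ x.2 ≤ 1 ∧ x.2 - x.1 ≤ 1 ∧ x.1 - x.2 ≤ 1}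

theorem stdHex_convex : Convex ℝ stdHex := by
  intro x hx y hy a b ha hb hab
  obtain ⟨h1, h2, h3, h4, h5, h6⟩ := hx
  obtain ⟨k1, k2, k3, k4, k5, k6⟩ := hy
  obtain rfl : b = 1 - a := by linarith
  simp only [stdHex, Set.mem_setOf_eq, Prod.fst_add, Prod.snd_add, Prod.smul_fst, Prod.smul_snd,
    smul_eq_mul]
  refine ⟨?_, ?_, ?_, ?_, ?_, ?_⟩ <;> nlinarith

theorem mem_of_convex {K : Set (ℝ × ℝ)} (hK : Convex ℝ K) (h0 : (0 : ℝ × ℝ) ∈ K)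
    {a b : ℝ × ℝ} (ha : a ∈ K) (hb : b ∈ K) {x : ℝ × ℝ} (α β : ℝ) (hα : 0 ≤ α) (hβ : 0 ≤ β)
    (h : α + β ≤ 1) (hx : x = α • a + β • b) : x ∈ K := by
  rcases eq_or_lt_of_le (add_nonneg hα hβ) with h' | h'
  · have h1 : α = 0 := by linarith
    have h2 : β = 0 := by linarith
    rw [hx, h1, h2]; simpa using h0
  · have hc : (α / (α + β)) • a + (β / (α + β)) • b ∈ K :=
      hK ha hb (by positivity) (by positivity) (by field_simp)
    have := hK hc h0 h'.le (by linarith : 0 ≤ 1 - (α + β)) (by ring)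
    rw [hx]
    convert this using 1
    rw [smul_zero, add_zero, smul_add, smul_smul, smul_smul, mul_div_cancel₀ _ h'.ne',
      mul_div_cancel₀ _ h'.ne']

theorem stdHex_eq : convexHull ℝ ({((1:ℝ), (0:ℝ)), (0, 1), (1, 1), (-1, 0), (0, -1), (-1, -1)} :
    Set (ℝ × ℝ)) = stdHex := by
  apply Set.Subset.antisymm
  · apply convexHull_min _ stdHex_convex
    intro x hx
    simp only [Set.mem_insert_iff, Set.mem_singleton_iff] at hx
    rcases hx with rfl | rfl | rfl | rfl | rfl | rfl <;> norm_num [stdHex]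
  · rintro ⟨s, t⟩ ⟨h1, h2, h3, h4, h5, h6⟩
    simp only at h1 h2 h3 h4 h5 h6
    set S : Set (ℝ × ℝ) := {((1:ℝ), (0:ℝ)), (0, 1), (1, 1), (-1, 0), (0, -1), (-1, -1)} with hS
    have hK := convex_convexHull ℝ S
    have m1 : ((1:ℝ), (0:ℝ)) ∈ convexHull ℝ S := subset_convexHull ℝ S (by simp [hS])
    have m2 : ((0:ℝ), (1:ℝ)) ∈ convexHull ℝ S := subset_convexHull ℝ S (by simp [hS])
    have m3 : ((1:ℝ), (1:ℝ)) ∈ convexHull ℝ S := subset_convexHull ℝ S (by simp [hS])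
    have m4 : ((-1:ℝ), (0:ℝ)) ∈ convexHull ℝ S := subset_convexHull ℝ S (by simp [hS])
    have m5 : ((0:ℝ), (-1:ℝ)) ∈ convexHull ℝ S := subset_convexHull ℝ S (by simp [hS])
    have m6 : ((-1:ℝ), (-1:ℝ)) ∈ convexHull ℝ S := subset_convexHull ℝ S (by simp [hS])
    have h0 : (0 : ℝ × ℝ) ∈ convexHull ℝ S := by
      have := hK m1 m4 (by norm_num : (0:ℝ) ≤ 1/2) (by norm_num : (0:ℝ) ≤ 1/2) (by norm_num)
      convert this using 1
      ext <;> norm_num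
    rcases le_total 0 s with hs | hs <;> rcases le_total 0 t with ht | ht
    · rcases le_total s t with hst | hst
      · exact mem_of_convex hK h0 m3 m2 s (t - s) hs (by linarith) (by linarith)
          (by ext <;> simp)
      · exact mem_of_convex hK h0 m3 m1 t (s - t) ht (by linarith) (by linarith)
          (by ext <;> simp)
    · exact mem_of_convex hK h0 m1 m5 s (-t) hs (by linarith) (by linarith) (by ext <;> simp)
    · exact mem_of_convex hK h0 m4 m2 (-s) t (by linarith) (by linarith) (by linarith)
        (by ext <;> simp)
    · rcases le_total s t with hst | hst
      · exact mem_of_convex hK h0 m6 m4 (-t) (t - s) (by linarith) (by linarith) (by linarith)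
          (by ext <;> simp)
      · exact mem_of_convex hK h0 m6 m5 (-s) (s - t) (by linarith) (by linarith) (by linarith)
          (by ext <;> simp)

theorem stdHex_closed : IsClosed stdHex := by
  simp only [stdHex, Set.setOf_and]
  refine IsClosed.inter ?_ (IsClosed.inter ?_ (IsClosed.inter ?_ (IsClosed.inter ?_
    (IsClosed.inter ?_ ?_)))) <;> exact isClosed_le (by fun_prop) (by fun_prop)

theorem stdHex_slice (s : ℝ) : MeasureTheory.volume (Prod.mk s ⁻¹' stdHex) =
    (Set.Icc (-1:ℝ) 1).indicator (fun s => ENNReal.ofReal (2 - |s|)) s := by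
  by_cases hs : s ∈ Set.Icc (-1:ℝ) 1
  · rw [Set.indicator_of_mem hs]
    have : Prod.mk s ⁻¹' stdHex = Set.Icc (max (-1) (s - 1)) (min 1 (s + 1)) := by
      ext t
      simp only [stdHex, Set.mem_preimage, Set.mem_setOf_eq, Set.mem_Icc, max_le_iff, le_min_iff]
      constructor
      · rintro ⟨h1, h2, h3, h4, h5, h6⟩
        refine ⟨⟨?_, ?_⟩, ?_, ?_⟩ <;> linarith
      · rintro ⟨⟨h1, h2⟩, h3, h4⟩
        refine ⟨hs.1, hs.2, ?_, ?_, ?_, ?_⟩ <;> linarith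
    rw [this, Real.volume_Icc]
    congr 1
    rcases le_total 0 s with h | h
    · rw [abs_of_nonneg h, max_eq_right (by linarith), min_eq_left (by linarith)]; ring
    · rw [abs_of_nonpos h, max_eq_left (by linarith), min_eq_right (by linarith)]; ring
  · rw [Set.indicator_of_notMem hs]
    have : Prod.mk s ⁻¹' stdHex = ∅ := by
      ext t
      simp only [stdHex, Set.mem_preimage, Set.mem_setOf_eq, Set.mem_empty_iff_false, iff_false]
      rintro ⟨h1, h2, -⟩
      exact hs ⟨h1, h2⟩
    rw [this, MeasureTheory.measure_empty]

theorem integral_two_sub_abs : ∫ s in (-1:ℝ)..1, (2 - |s|) = 3 := by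
  have hc : Continuous fun s : ℝ => 2 - |s| := by fun_prop
  rw [← intervalIntegral.integral_add_adjacent_intervals (b := 0)
    (hc.intervalIntegrable _ _) (hc.intervalIntegrable _ _)]
  have e1 : ∫ s in (-1:ℝ)..0, (2 - |s|) = ∫ s in (-1:ℝ)..0, (2 + s) := by
    apply intervalIntegral.integral_congr
    intro s hs
    rw [Set.uIcc_of_le (by norm_num)] at hs
    simp only [abs_of_nonpos hs.2]; ring
  have e2 : ∫ s in (0:ℝ)..1, (2 - |s|) = ∫ s in (0:ℝ)..1, (2 - s) := by
    apply intervalIntegral.integral_congr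
    intro s hs
    rw [Set.uIcc_of_le (by norm_num)] at hs
    simp only [abs_of_nonneg hs.1]
  rw [e1, e2, intervalIntegral.integral_add (by simp) (by simp),
    intervalIntegral.integral_sub (by simp) (by simp)]
  norm_num

theorem stdHex_volume : MeasureTheory.volume stdHex = ENNReal.ofReal 3 := by
  rw [MeasureTheory.Measure.volume_eq_prod,
    MeasureTheory.Measure.prod_apply stdHex_closed.measurableSet]
  simp_rw [stdHex_slice]
  have hc : Continuous fun s : ℝ => 2 - |s| := by fun_prop
  rw [MeasureTheory.lintegral_indicator measurableSet_Icc,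
    ← MeasureTheory.ofReal_integral_eq_lintegral_ofReal
      (hc.integrableOn_Icc)
      ((MeasureTheory.ae_restrict_iff' measurableSet_Icc).2 (Filter.Eventually.of_forall
        fun s hs => by
          have := abs_le.2 hs
          simp only [Pi.zero_apply]; linarith)),
    MeasureTheory.integral_Icc_eq_integral_Ioc,
    ← intervalIntegral.integral_of_le (by norm_num), integral_two_sub_abs]

theorem hex_volume (u v : ℝ × ℝ) :
    MeasureTheory.volume (convexHull ℝ ({u, v, u + v, -u, -v, -(u + v)} : Set (ℝ × ℝ)))
      = ENNReal.ofReal (3 * |u.1 * v.2 - v.1 * u.2|) := by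
  set L : ℝ × ℝ →ₗ[ℝ] ℝ × ℝ := Matrix.toLin (Module.Basis.finTwoProd ℝ) (Module.Basis.finTwoProd ℝ)
    !![u.1, v.1; u.2, v.2] with hL
  have hdet : LinearMap.det L = u.1 * v.2 - v.1 * u.2 := by
    rw [hL, LinearMap.det_toLin, Matrix.det_fin_two_of]
  have himg : ({u, v, u + v, -u, -v, -(u + v)} : Set (ℝ × ℝ)) =
      L '' {((1:ℝ), (0:ℝ)), (0, 1), (1, 1), (-1, 0), (0, -1), (-1, -1)} := by
    simp only [Set.image_insert_eq, Set.image_singleton, hL, Matrix.toLin_finTwoProd_apply]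
    congr! 1 <;> [skip; congr! 1 <;> [skip; congr! 1 <;> [skip; congr! 1 <;> [skip; congr! 1 <;> [skip; congr! 1]]]]] <;>
      ext <;> simp <;> ring
  rw [himg, ← LinearMap.image_convexHull, stdHex_eq,
    MeasureTheory.Measure.addHaar_image_linearMap, stdHex_volume, hdet,
    ← ENNReal.ofReal_mul (abs_nonneg _), mul_comm]

theorem curve_aux (p : ℝ) (hp : 1 < p) (τ : ℝ) (hτ : 0 ≤ τ) :
    |(1 + τ ^ p) ^ (-(1 / p))| ^ p + |τ * (1 + τ ^ p) ^ (-(1 / p))| ^ p = 1 := by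
  have h1 : 0 < 1 + τ ^ p := by have := Real.rpow_nonneg hτ p; linarith
  have h2 : 0 < (1 + τ ^ p) ^ (-(1 / p)) := Real.rpow_pos_of_pos h1 _
  rw [abs_of_pos h2, abs_of_nonneg (mul_nonneg hτ h2.le), Real.mul_rpow hτ h2.le,
    ← Real.rpow_mul h1.le, show -(1 / p) * p = -1 by field_simp, Real.rpow_neg_one]
  field_simp

/-- For real `p > 1`, `τ ≥ 0`, `σ ≥ 0`, the points
`u = ((1+τᵖ)^(-1/p), τ(1+τᵖ)^(-1/p))` and `v = (-(1+σᵖ)^(-1/p), σ(1+σᵖ)^(-1/p))`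
lie on the curve `|x|ᵖ + |y|ᵖ = 1`, and the hexagon `conv{±u, ±v, ±(u+v)}` has
area `A(σ,p) = 3(τ+σ)(1+τᵖ)^(-1/p)(1+σᵖ)^(-1/p)`. -/
theorem statement_7 (p : ℝ) (hp : 1 < p) (τ σ : ℝ) (hτ : 0 ≤ τ) (hσ : 0 ≤ σ)
    (u v : ℝ × ℝ)
    (hu : u = ((1 + τ ^ p) ^ (-(1 / p)), τ * (1 + τ ^ p) ^ (-(1 / p))))
    (hv : v = (-((1 + σ ^ p) ^ (-(1 / p))), σ * (1 + σ ^ p) ^ (-(1 / p)))) :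
    |u.1| ^ p + |u.2| ^ p = 1 ∧ |v.1| ^ p + |v.2| ^ p = 1 ∧
    MeasureTheory.volume (convexHull ℝ ({u, v, u + v, -u, -v, -(u + v)} : Set (ℝ × ℝ)))
      = ENNReal.ofReal
          (3 * (τ + σ) * (1 + τ ^ p) ^ (-(1 / p)) * (1 + σ ^ p) ^ (-(1 / p))) := by
  refine ⟨by rw [hu]; exact curve_aux p hp τ hτ, ?_, ?_⟩
  · rw [hv]
    simp only [abs_neg]
    exact curve_aux p hp σ hσ
  · have h1 : 0 ≤ (1 + τ ^ p) ^ (-(1 / p)) :=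
      Real.rpow_nonneg (by have := Real.rpow_nonneg hτ p; linarith) _
    have h2 : 0 ≤ (1 + σ ^ p) ^ (-(1 / p)) :=
      Real.rpow_nonneg (by have := Real.rpow_nonneg hσ p; linarith) _
    rw [hex_volume, hu, hv]
    simp only
    generalize (1 + τ ^ p) ^ (-(1 / p)) = a at *
    generalize (1 + σ ^ p) ^ (-(1 / p)) = b at *
    rw [show a * (σ * b) - -b * (τ * a) = (τ + σ) * a * b by ring, abs_of_nonneg (by positivity)]
    congr 1
    ring
end

section
/- Let p > 1 be real. The infimum, over all triples a, b, c ∈ ℝ² such that the centrally symmetric hexagon H = conv{a, b, c, −a, −b, −c} contains the closed Minkowski ball {(x,y) : |x|ᵖ + |y|ᵖ ≤ 1} and the boundary of H meets the curve |x|ᵖ + |y|ᵖ = 1 in three pairs of points ±q₁, ±q₂, ±q₃, of the area of H, equals 4·Δ(D_p), where Δ(D_p) is the critical determinant of D_p. -/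
noncomputable section

/-- The cross product of two plane vectors. -/
def crs (u v : ℝ × ℝ) : ℝ := u.1 * v.2 - u.2 * v.1

/-- The `p`-th power of the norm. -/
def PP (p : ℝ) (z : ℝ × ℝ) : ℝ := |z.1| ^ p + |z.2| ^ p

/-- The `p`-norm. -/
def NN (p : ℝ) (z : ℝ × ℝ) : ℝ := (PP p z) ^ (1 / p)

lemma PP_nonneg (p : ℝ) (z : ℝ × ℝ) : 0 ≤ PP p z := by unfold PP; positivity

lemma NN_nonneg (p : ℝ) (z : ℝ × ℝ) : 0 ≤ NN p z := Real.rpow_nonneg (PP_nonneg p z) _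

lemma NN_add (p : ℝ) (hp : 1 < p) (x y : ℝ × ℝ) : NN p (x + y) ≤ NN p x + NN p y := by
  have := Real.Lp_add_le (Finset.univ : Finset (Fin 2)) ![x.1, x.2] ![y.1, y.2] hp.le
  simpa [Fin.sum_univ_two, NN, PP] using this

lemma NN_smul (p : ℝ) (hp : 1 < p) (c : ℝ) (x : ℝ × ℝ) : NN p (c • x) = |c| * NN p x := by
  have h0 : p ≠ 0 := by linarith
  unfold NN PP
  simp only [Prod.smul_fst, Prod.smul_snd, smul_eq_mul, abs_mul]
  rw [Real.mul_rpow (abs_nonneg _) (abs_nonneg _), Real.mul_rpow (abs_nonneg _) (abs_nonneg _),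
    ← mul_add, Real.mul_rpow (by positivity) (by positivity), ← Real.rpow_mul (abs_nonneg _)]
  rw [mul_one_div_cancel h0, Real.rpow_one]

lemma NN_le_one (p : ℝ) (hp : 1 < p) (z : ℝ × ℝ) : NN p z ≤ 1 ↔ PP p z ≤ 1 := by
  unfold NN
  have hp' : 0 < 1 / p := by positivity
  constructor
  · intro h
    by_contra h2
    push Not at h2
    have := Real.one_lt_rpow h2 hp'
    linarith
  · intro h
    exact Real.rpow_le_one (PP_nonneg p z) h hp'.le

lemma one_le_NN (p : ℝ) (hp : 1 < p) (z : ℝ × ℝ) : 1 ≤ NN p z ↔ 1 ≤ PP p z := by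
  unfold NN
  have hp' : 0 < 1 / p := by positivity
  constructor
  · intro h
    by_contra h2
    push Not at h2
    have := Real.rpow_lt_one (PP_nonneg p z) h2 hp'
    linarith
  · intro h
    exact Real.one_le_rpow h hp'.le

lemma NN_eq_one (p : ℝ) (hp : 1 < p) (z : ℝ × ℝ) : NN p z = 1 ↔ PP p z = 1 := by
  have h1 := NN_le_one p hp z
  have h2 := one_le_NN p hp z
  constructor
  · intro h
    exact le_antisymm (h1.1 h.le) (h2.1 h.ge)
  · intro h
    exact le_antisymm (h1.2 h.le) (h2.2 h.ge)

lemma abs_fst_le_NN (p : ℝ) (hp : 1 < p) (z : ℝ × ℝ) : |z.1| ≤ NN p z := by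
  have h0 : p ≠ 0 := by linarith
  have : |z.1| = (|z.1| ^ p) ^ (1 / p) := by
    rw [← Real.rpow_mul (abs_nonneg _)]; field_simp; simp
  rw [this]
  unfold NN PP
  apply Real.rpow_le_rpow (by positivity) _ (by positivity)
  have : 0 ≤ |z.2| ^ p := by positivity
  linarith

lemma abs_snd_le_NN (p : ℝ) (hp : 1 < p) (z : ℝ × ℝ) : |z.2| ≤ NN p z := by
  have h0 : p ≠ 0 := by linarith
  have : |z.2| = (|z.2| ^ p) ^ (1 / p) := by
    rw [← Real.rpow_mul (abs_nonneg _)]; field_simp; simp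
  rw [this]
  unfold NN PP
  apply Real.rpow_le_rpow (by positivity) _ (by positivity)
  have : 0 ≤ |z.1| ^ p := by positivity
  linarith

lemma NN_pos (p : ℝ) (hp : 1 < p) (z : ℝ × ℝ) (hz : z ≠ 0) : 0 < NN p z := by
  by_contra h
  push Not at h
  apply hz
  have h1 := abs_fst_le_NN p hp z
  have h2 := abs_snd_le_NN p hp z
  have h3 : |z.1| ≤ 0 := h1.trans h
  have h4 : |z.2| ≤ 0 := h2.trans h
  ext
  · simpa using h3
  · simpa using h4

lemma NN_continuous (p : ℝ) (hp : 1 < p) : Continuous (NN p) := by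
  unfold NN PP
  have h0 : 0 ≤ p := by linarith
  have h1 : 0 ≤ 1 / p := by positivity
  apply Continuous.rpow_const _ (fun _ => Or.inr h1)
  apply Continuous.add
  · exact Continuous.rpow_const (by fun_prop) (fun _ => Or.inr h0)
  · exact Continuous.rpow_const (by fun_prop) (fun _ => Or.inr h0)

/-- Intermediate value step. -/
lemma exists_triangle (p : ℝ) (hp : 1 < p) (u v : ℝ × ℝ) (hD : crs u v ≠ 0) (hu : NN p u = 1) :
    ∃ A B : ℝ, 0 < B ∧ NN p (A • u + B • v) = 1 ∧ NN p (A • u + B • v - u) = 1 := by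
  let w : ℝ → ℝ × ℝ := fun θ => Real.cos θ • u + Real.sin θ • v
  have hw : ∀ θ, w θ ≠ 0 := by
    intro θ h
    have h1 : Real.cos θ * u.1 + Real.sin θ * v.1 = 0 := by
      simpa [w] using congrArg Prod.fst h
    have h2 : Real.cos θ * u.2 + Real.sin θ * v.2 = 0 := by
      simpa [w] using congrArg Prod.snd h
    have h3 : Real.cos θ * crs u v = 0 := by unfold crs; linear_combination h1 * v.2 - h2 * v.1
    have h4 : Real.sin θ * crs u v = 0 := by unfold crs; linear_combination h2 * u.1 - h1 * u.2
    have h5 : Real.cos θ = 0 := by simpa [hD] using h3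
    have h6 : Real.sin θ = 0 := by simpa [hD] using h4
    have := Real.sin_sq_add_cos_sq θ
    rw [h5, h6] at this
    norm_num at this
  have hwc : Continuous w := by
    simp only [w]
    fun_prop
  have hN := NN_continuous p hp
  have hc : Continuous (fun θ => NN p ((NN p (w θ))⁻¹ • w θ - u)) := by
    apply hN.comp
    apply Continuous.sub _ continuous_const
    exact Continuous.smul ((hN.comp hwc).inv₀ (fun θ => (NN_pos p hp _ (hw θ)).ne')) hwc
  have h0 : NN p ((NN p (w 0))⁻¹ • w 0 - u) = 0 := by
    have : w 0 = u := by simp [w]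
    rw [this, hu]
    have h := NN_smul p hp 0 u
    simpa using h
  have hpi : NN p ((NN p (w Real.pi))⁻¹ • w Real.pi - u) = 2 := by
    have : w Real.pi = (-1 : ℝ) • u := by simp [w]
    rw [this, NN_smul p hp, hu]
    have h := NN_smul p hp (-2) u
    rw [hu] at h
    have e : (|(-1:ℝ)| * 1)⁻¹ • (-1 : ℝ) • u - u = (-2 : ℝ) • u := by
      simp; module
    rw [e, h]; norm_num
  have := intermediate_value_Icc Real.pi_pos.le hc.continuousOn
  have h1 : (1 : ℝ) ∈ Set.Icc (NN p ((NN p (w 0))⁻¹ • w 0 - u))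
      (NN p ((NN p (w Real.pi))⁻¹ • w Real.pi - u)) := by
    rw [h0, hpi]; constructor <;> norm_num
  obtain ⟨θ, hθ, hval⟩ := this h1
  simp only at hval
  have hpos := NN_pos p hp _ (hw θ)
  have e : (NN p (w θ))⁻¹ • w θ
      = ((NN p (w θ))⁻¹ * Real.cos θ) • u + ((NN p (w θ))⁻¹ * Real.sin θ) • v := by
    simp only [w]; module
  have hn1 : NN p ((NN p (w θ))⁻¹ • w θ) = 1 := by
    rw [NN_smul p hp, abs_of_pos (by positivity)]; field_simp
  rw [e] at hval hn1
  refine ⟨_, _, ?_, hn1, hval⟩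
  have hs := Real.sin_nonneg_of_mem_Icc hθ
  rcases hs.lt_or_eq with hs | hs
  · positivity
  · exfalso
    rw [← hs] at hval hn1
    simp only [mul_zero, zero_smul, add_zero] at hval hn1
    rw [NN_smul p hp, hu] at hn1
    generalize (NN p (w θ))⁻¹ * Real.cos θ = A at *
    have e2 : A • u - u = (A - 1) • u := by module
    rw [e2, NN_smul p hp, hu] at hval
    rcases abs_cases A with h | h <;> rcases abs_cases (A - 1) with h' | h' <;> linarith

/-- Trapezoid step. -/
lemma triangle_le (p : ℝ) (hp : 1 < p) (u v : ℝ × ℝ) (hu : NN p u = 1)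
    (hv : ∀ k : ℤ, 1 ≤ NN p (v + (k : ℝ) • u)) (A B : ℝ) (hB : 0 < B)
    (h1 : NN p (A • u + B • v) = 1) (h2 : NN p (A • u + B • v - u) = 1) : B ≤ 1 := by
  by_contra hlt
  push Not at hlt
  set x := A • u + B • v with hx
  obtain ⟨l, hl⟩ : ∃ l, l = B⁻¹ := ⟨_, rfl⟩
  have hl0 : 0 < l := by rw [hl]; positivity
  have hl1 : l < 1 := by rw [hl]; exact inv_lt_one_of_one_lt₀ hlt
  have hlB : l * B = 1 := by rw [hl]; field_simp
  obtain ⟨k, hk⟩ : ∃ k : ℤ, k = ⌊l * A⌋ := ⟨_, rfl⟩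
  have hk1 : (k : ℝ) ≤ l * A := by rw [hk]; exact Int.floor_le _
  have hk2 : l * A < k + 1 := by rw [hk]; exact Int.lt_floor_add_one _
  have key := hv k
  have e : v + (k : ℝ) • u = l • x - (l * A - k) • u := by
    rw [hx, smul_add, smul_smul l B, hlB]; module
  set d := l * A - k with hd
  rw [e] at key
  rcases le_total d l with hdl | hdl
  · have e2 : l • x - d • u = (l - d) • x + d • (x - u) := by module
    rw [e2] at key
    have := NN_add p hp ((l - d) • x) (d • (x - u))
    rw [NN_smul p hp, NN_smul p hp, h1, h2, abs_of_nonneg (by linarith),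
      abs_of_nonneg (by linarith)] at this
    linarith
  · have e2 : l • x - d • u = l • (x - u) + (l - d) • u := by module
    rw [e2] at key
    have := NN_add p hp (l • (x - u)) ((l - d) • u)
    rw [NN_smul p hp, NN_smul p hp, hu, h2, abs_of_nonneg (by linarith),
      abs_of_nonpos (by linarith)] at this
    linarith

/-- Shortest vector, extended to a basis. -/
lemma exists_shortest (p : ℝ) (hp : 1 < p) (u v : ℝ × ℝ) (hD : crs u v ≠ 0) :
    ∃ m k s t : ℤ, m * t - k * s = 1 ∧
      ∀ i j : ℤ, (i ≠ 0 ∨ j ≠ 0) →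
        NN p ((m : ℝ) • u + (k : ℝ) • v) ≤ NN p ((i : ℝ) • u + (j : ℝ) • v) := by
  let n : ℤ × ℤ → ℝ := fun z => NN p ((z.1 : ℝ) • u + (z.2 : ℝ) • v)
  let R := n (1, 0)
  obtain ⟨M, hM⟩ : ∃ M : ℤ, R * (|u.1| + |u.2| + |v.1| + |v.2|) / |crs u v| ≤ M :=
    ⟨_, Int.le_ceil _⟩
  have hDp : 0 < |crs u v| := abs_pos.2 hD
  have hfin : ({z : ℤ × ℤ | z ≠ 0 ∧ n z ≤ R}).Finite := by
    apply (Set.finite_Icc ((-M, -M) : ℤ × ℤ) (M, M)).subset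
    rintro ⟨i, j⟩ ⟨-, hij⟩
    have hij' : NN p ((i : ℝ) • u + (j : ℝ) • v) ≤ R := hij
    have a1 := (abs_fst_le_NN p hp _).trans hij'
    have a2 := (abs_snd_le_NN p hp _).trans hij'
    set z := (i : ℝ) • u + (j : ℝ) • v with hz
    have hz1 : z.1 = i * u.1 + j * v.1 := by simp [hz]
    have hz2 : z.2 = i * u.2 + j * v.2 := by simp [hz]
    have hR : 0 ≤ R := NN_nonneg _ _
    have b1 : |(i : ℝ)| * |crs u v| ≤ R * (|u.1| + |u.2| + |v.1| + |v.2|) := by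
      rw [← abs_mul]
      have : (i : ℝ) * crs u v = z.1 * v.2 - z.2 * v.1 := by rw [hz1, hz2]; unfold crs; ring
      rw [this]
      have := abs_sub (z.1 * v.2) (z.2 * v.1)
      rw [abs_mul, abs_mul] at this
      nlinarith [abs_nonneg v.1, abs_nonneg v.2, abs_nonneg u.1, abs_nonneg u.2]
    have b2 : |(j : ℝ)| * |crs u v| ≤ R * (|u.1| + |u.2| + |v.1| + |v.2|) := by
      rw [← abs_mul]
      have : (j : ℝ) * crs u v = z.2 * u.1 - z.1 * u.2 := by rw [hz1, hz2]; unfold crs; ring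
      rw [this]
      have := abs_sub (z.2 * u.1) (z.1 * u.2)
      rw [abs_mul, abs_mul] at this
      nlinarith [abs_nonneg v.1, abs_nonneg v.2, abs_nonneg u.1, abs_nonneg u.2]
    have c1 : |(i : ℝ)| ≤ M := ((le_div_iff₀ hDp).2 b1).trans hM
    have c2 : |(j : ℝ)| ≤ M := ((le_div_iff₀ hDp).2 b2).trans hM
    have d1 : |i| ≤ M := by exact_mod_cast c1
    have d2 : |j| ≤ M := by exact_mod_cast c2
    rw [abs_le] at d1 d2
    exact ⟨⟨d1.1, d2.1⟩, ⟨d1.2, d2.2⟩⟩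
  obtain ⟨⟨m, k⟩, ⟨hmk0, hmkR⟩, hmin⟩ := Set.exists_min_image _ n hfin
    ⟨(1, 0), by simp, le_refl _⟩
  have hmin' : ∀ i j : ℤ, (i ≠ 0 ∨ j ≠ 0) → n (m, k) ≤ n (i, j) := by
    intro i j hij
    rcases le_total (n (i, j)) R with h | h
    · apply hmin _ ⟨_, h⟩
      intro h0
      simp at h0
      tauto
    · exact hmkR.trans h
  have hmk : m ≠ 0 ∨ k ≠ 0 := by
    by_contra h
    push Not at h
    apply hmk0
    simp [h.1, h.2]
  have hg : 0 < Int.gcd m k := Int.gcd_pos_iff.2 hmk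
  obtain ⟨m', k', hco, hm, hk⟩ := Int.exists_gcd_one hg
  have hg1 : Int.gcd m k = 1 := by
    have hne : m' ≠ 0 ∨ k' ≠ 0 := by
      by_contra h
      push Not at h
      rw [h.1, h.2] at hco
      simp at hco
    have h1 := hmin' m' k' hne
    have h2 : n (m, k) = (Int.gcd m k : ℝ) * n (m', k') := by
      simp only [n]
      rw [← abs_of_pos (show (0:ℝ) < (Int.gcd m k : ℝ) by exact_mod_cast hg), ← NN_smul p hp]
      congr 1
      have e1 : (m : ℝ) = m' * (Int.gcd m k : ℝ) := by exact_mod_cast hm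
      have e2 : (k : ℝ) = k' * (Int.gcd m k : ℝ) := by exact_mod_cast hk
      generalize (Int.gcd m k : ℝ) = G at *
      rw [e1, e2]; module
    have h3 : 0 < n (m', k') := by
      apply NN_pos p hp
      intro h
      have h1 : m' * u.1 + k' * v.1 = 0 := by simpa using congrArg Prod.fst h
      have h2 : m' * u.2 + k' * v.2 = 0 := by simpa using congrArg Prod.snd h
      have h3 : m' * crs u v = 0 := by unfold crs; linear_combination h1 * v.2 - h2 * v.1
      have h4 : k' * crs u v = 0 := by unfold crs; linear_combination h2 * u.1 - h1 * u.2
      have h5 : (m' : ℝ) = 0 := by simpa [hD] using h3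
      have h6 : (k' : ℝ) = 0 := by simpa [hD] using h4
      norm_cast at h5 h6
      tauto
    rw [h2] at h1
    have h4 : (Int.gcd m k : ℝ) ≤ 1 := by
      by_contra h
      push Not at h
      nlinarith
    have h5 : Int.gcd m k ≤ 1 := by exact_mod_cast h4
    omega
  refine ⟨m, k, - Int.gcdB m k, Int.gcdA m k, ?_, hmin'⟩
  have := Int.gcd_eq_gcd_ab m k
  rw [hg1] at this
  push_cast at this
  linarith

lemma smul_crs (a b : ℝ) (u v : ℝ × ℝ) : crs (a • u) (b • v) = a * b * crs u v := by
  simp [crs]; ring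

/-- From an admissible lattice to an inscribed hexagon. -/
lemma exists_inscribed (p : ℝ) (hp : 1 < p) (u v : ℝ × ℝ) (h : IsAdmissible p u v) :
    ∃ x y : ℝ × ℝ, NN p x = 1 ∧ NN p y = 1 ∧ NN p (y - x) = 1 ∧ crs x y ≠ 0 ∧
      |crs x y| ≤ covol u v := by
  obtain ⟨hD, hadm⟩ := h
  have hcov : covol u v = |crs u v| := rfl
  have hD' : crs u v ≠ 0 := by simpa [hcov] using hD
  obtain ⟨m, k, s, t, hdet, hmin⟩ := exists_shortest p hp u v hD'
  have hdetR : (m : ℝ) * t - k * s = 1 := by exact_mod_cast hdet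
  set u0 := (m : ℝ) • u + (k : ℝ) • v with hu0
  set v0 := (s : ℝ) • u + (t : ℝ) • v with hv0
  have hc : crs u0 v0 = crs u v := by
    have : crs u0 v0 = (m * t - k * s) * crs u v := by simp [hu0, hv0, crs]; ring
    rw [this, hdetR, one_mul]
  have hu0ne : u0 ≠ 0 := by
    intro h0
    rw [h0] at hc
    apply hD'
    rw [← hc]; simp [crs]
  have hN1 : 1 ≤ NN p u0 := by
    rw [one_le_NN p hp]
    apply hadm _ _ hu0ne
    exact ⟨m, k, by rw [hu0, Int.cast_smul_eq_zsmul, Int.cast_smul_eq_zsmul]⟩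
  set r := NN p u0 with hr
  have hr0 : 0 < r := by linarith
  have hu1 : NN p (r⁻¹ • u0) = 1 := by
    rw [NN_smul p hp, abs_of_pos (by positivity), ← hr]; field_simp
  have hc1 : crs (r⁻¹ • u0) (r⁻¹ • v0) = r⁻¹ * r⁻¹ * crs u v := by rw [smul_crs, hc]
  have hc1ne : crs (r⁻¹ • u0) (r⁻¹ • v0) ≠ 0 := by
    rw [hc1]; positivity
  obtain ⟨A, B, hB, e1, e2⟩ := exists_triangle p hp _ _ hc1ne hu1
  have hB1 : B ≤ 1 := by
    refine triangle_le p hp _ _ hu1 ?_ A B hB e1 e2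
    intro j
    have e : r⁻¹ • v0 + (j : ℝ) • r⁻¹ • u0 = r⁻¹ • (((s + j * m : ℤ) : ℝ) • u
        + ((t + j * k : ℤ) : ℝ) • v) := by
      rw [hu0, hv0]; push_cast; module
    rw [e, NN_smul p hp, abs_of_pos (by positivity)]
    have : r ≤ NN p (((s + j * m : ℤ) : ℝ) • u + ((t + j * k : ℤ) : ℝ) • v) := by
      apply hmin
      by_contra hh
      push Not at hh
      have : m * (t + j * k) - k * (s + j * m) = 1 := by linarith
      rw [hh.1, hh.2] at this
      simp at this
    rw [inv_mul_eq_div, le_div_iff₀ hr0]; linarith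
  have hcc : crs (r⁻¹ • u0) (A • r⁻¹ • u0 + B • r⁻¹ • v0) = B * (r⁻¹ * r⁻¹ * crs u v) := by
    rw [← hc1]; simp [crs]; ring
  refine ⟨_, _, hu1, e1, e2, ?_, ?_⟩
  · rw [hcc]; positivity
  · rw [hcc, hcov, abs_mul, abs_mul, abs_of_pos hB, abs_of_pos (by positivity)]
    have hri : r⁻¹ ≤ 1 := inv_le_one_of_one_le₀ hN1
    have hri0 : 0 < r⁻¹ := by positivity
    have : B * (r⁻¹ * r⁻¹) ≤ 1 := by
      have : r⁻¹ * r⁻¹ ≤ 1 := by nlinarith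
      nlinarith [mul_pos hri0 hri0]
    nlinarith [abs_nonneg (crs u v)]


lemma strip_convex (k : ℝ × ℝ →L[ℝ] ℝ) (B : ℝ) : Convex ℝ {z | |k z| ≤ B} := by
  intro x hx y hy a b ha hb hab
  have hx' : |k x| ≤ B := hx
  have hy' : |k y| ≤ B := hy
  change |k (a • x + b • y)| ≤ B
  rw [map_add, map_smul, map_smul, smul_eq_mul, smul_eq_mul]
  rw [abs_le] at *
  have hB : B = a * B + b * B := by rw [← add_mul, hab, one_mul]
  constructor <;> nlinarith

lemma abs_rpow_mid_le (p : ℝ) (hp : 1 < p) (x y : ℝ) :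
    |(x + y) / 2| ^ p ≤ (|x| ^ p + |y| ^ p) / 2 := by
  have h1 : |(x + y) / 2| ≤ (|x| + |y|) / 2 := by
    rw [abs_div, abs_two]; have := abs_add_le x y; linarith
  have h2 := Real.rpow_le_rpow (abs_nonneg _) h1 (by linarith : 0 ≤ p)
  have h3 := (convexOn_rpow hp.le).2 (abs_nonneg x : |x| ∈ Set.Ici 0)
    (abs_nonneg y : |y| ∈ Set.Ici 0) (by norm_num : (0:ℝ) ≤ 1/2) (by norm_num : (0:ℝ) ≤ 1/2)
    (by norm_num)
  simp only [smul_eq_mul] at h3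
  have e : (|x| + |y|) / 2 = 1 / 2 * |x| + 1 / 2 * |y| := by ring
  rw [e] at h2
  linarith

lemma abs_rpow_mid_lt (p : ℝ) (hp : 1 < p) (x y : ℝ) (hxy : x ≠ y) :
    |(x + y) / 2| ^ p < (|x| ^ p + |y| ^ p) / 2 := by
  by_cases hab : |x| = |y|
  · rcases abs_eq_abs.1 hab with h | h
    · exact absurd h hxy
    · have hy : y ≠ 0 := by
        intro h0; apply hxy; rw [h, h0]; simp
      have : 0 < |y| ^ p := Real.rpow_pos_of_pos (abs_pos.2 hy) _
      rw [h]
      simp only [neg_add_cancel, zero_div, abs_zero, abs_neg]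
      rw [Real.zero_rpow (by linarith)]
      linarith
  have h1 : |(x + y) / 2| ≤ (|x| + |y|) / 2 := by
    rw [abs_div, abs_two]; have := abs_add_le x y; linarith
  have h2 := Real.rpow_le_rpow (abs_nonneg _) h1 (by linarith : 0 ≤ p)
  have h3 := (strictConvexOn_rpow hp).2 (abs_nonneg x : |x| ∈ Set.Ici 0)
    (abs_nonneg y : |y| ∈ Set.Ici 0) hab (by norm_num : (0:ℝ) < 1/2) (by norm_num : (0:ℝ) < 1/2)
    (by norm_num)
  simp only [smul_eq_mul] at h3
  have e : (|x| + |y|) / 2 = 1 / 2 * |x| + 1 / 2 * |y| := by ring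
  rw [e] at h2
  linarith

lemma PP_mid_lt (p : ℝ) (hp : 1 < p) (x y : ℝ × ℝ) (hxy : x ≠ y) (hx : PP p x = 1)
    (hy : PP p y = 1) : PP p ((1 / 2 : ℝ) • (x + y)) < 1 := by
  have e : PP p ((1 / 2 : ℝ) • (x + y)) = |(x.1 + y.1) / 2| ^ p + |(x.2 + y.2) / 2| ^ p := by
    unfold PP
    congr 3
    · simp; ring
    · simp; ring
  rw [e]
  unfold PP at hx hy
  have h1 := abs_rpow_mid_le p hp x.1 y.1
  have h2 := abs_rpow_mid_le p hp x.2 y.2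
  by_cases h : x.1 = y.1
  · have h' : x.2 ≠ y.2 := fun h2 => hxy (Prod.ext h h2)
    have := abs_rpow_mid_lt p hp _ _ h'
    linarith
  · have := abs_rpow_mid_lt p hp _ _ h
    linarith

lemma abs_le_NN (p : ℝ) (hp : 1 < p) (f : ℝ × ℝ →L[ℝ] ℝ) (B : ℝ)
    (hf : ∀ z, PP p z ≤ 1 → |f z| ≤ B) (z : ℝ × ℝ) : |f z| ≤ B * NN p z := by
  by_cases hz : z = 0
  · subst hz
    have h0 : NN p (0 : ℝ × ℝ) = 0 := by simpa using NN_smul p hp 0 0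
    simp [h0]
  have hN := NN_pos p hp z hz
  have h1 : PP p ((NN p z)⁻¹ • z) ≤ 1 := by
    rw [← NN_le_one p hp, NN_smul p hp, abs_of_pos (by positivity)]
    field_simp; exact le_refl _
  have h2 := hf _ h1
  rw [map_smul, smul_eq_mul, abs_mul, abs_of_pos (by positivity), inv_mul_eq_div,
    div_le_iff₀ hN] at h2
  exact h2

lemma exists_dual (p : ℝ) (hp : 1 < p) (u : ℝ × ℝ) (hu : PP p u = 1) :
    ∃ f : ℝ × ℝ →L[ℝ] ℝ, f u = 1 ∧ (∀ z, PP p z ≤ 1 → |f z| ≤ 1) := by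
  have hs : ∀ x : ℝ, ∃ s : ℝ, |s| = 1 ∧ s * x = |x| := by
    intro x
    rcases abs_cases x with h | h
    · exact ⟨1, by simp, by rw [h.1]; ring⟩
    · exact ⟨-1, by simp, by rw [h.1]; ring⟩
  obtain ⟨s, hs1, hs2⟩ := hs u.1
  obtain ⟨t, ht1, ht2⟩ := hs u.2
  have hp0 : 0 < p := by linarith
  have hq : p.HolderConjugate (p / (p - 1)) := Real.HolderConjugate.conjExponent hp
  have hmul : ∀ x : ℝ, |x| ^ (p - 1) * |x| = |x| ^ p := by
    intro x
    by_cases hx : x = 0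
    · subst hx; simp [Real.zero_rpow hp0.ne']
    · rw [← Real.rpow_add_one (abs_pos.2 hx).ne']; congr 1; ring
  have hy : ∀ x y : ℝ, |x| ^ (p - 1) * |y| ≤ |x| ^ p * (1 - 1 / p) + |y| ^ p / p := by
    intro x y
    have := Real.young_inequality_of_nonneg (abs_nonneg y)
      (Real.rpow_nonneg (abs_nonneg x) (p - 1)) hq
    rw [← Real.rpow_mul (abs_nonneg x)] at this
    have e : (p - 1) * (p / (p - 1)) = p := by
      have : p - 1 ≠ 0 := by linarith
      field_simp
    rw [e] at this
    have e2 : |x| ^ p / (p / (p - 1)) = |x| ^ p * (1 - 1 / p) := by field_simp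
    rw [e2] at this
    linarith
  let f : ℝ × ℝ →L[ℝ] ℝ := (s * |u.1| ^ (p - 1)) • ContinuousLinearMap.fst ℝ ℝ ℝ
    + (t * |u.2| ^ (p - 1)) • ContinuousLinearMap.snd ℝ ℝ ℝ
  have hf : ∀ z, f z = s * |u.1| ^ (p - 1) * z.1 + t * |u.2| ^ (p - 1) * z.2 := by
    intro z; simp [f]
  refine ⟨f, ?_, ?_⟩
  · unfold PP at hu
    rw [← hmul, ← hmul] at hu
    rw [hf]
    linear_combination |u.1| ^ (p - 1) * hs2 + |u.2| ^ (p - 1) * ht2 + hu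
  · intro z hz
    rw [hf]
    refine (abs_add_le _ _).trans ?_
    rw [abs_mul, abs_mul, abs_mul, abs_mul, hs1, ht1, one_mul, one_mul,
      abs_of_nonneg (Real.rpow_nonneg (abs_nonneg u.1) _),
      abs_of_nonneg (Real.rpow_nonneg (abs_nonneg u.2) _)]
    have h1 := hy u.1 z.1
    have h2 := hy u.2 z.2
    unfold PP at hu hz
    have h3 : |z.1| ^ p / p + |z.2| ^ p / p ≤ 1 / p := by
      rw [← add_div]; gcongr
    have h4 : |u.1| ^ p * (1 - 1 / p) + |u.2| ^ p * (1 - 1 / p) = 1 - 1 / p := by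
      rw [← add_mul, hu, one_mul]
    linarith

lemma dual_strict (p : ℝ) (hp : 1 < p) (u : ℝ × ℝ) (hu : PP p u = 1) (f : ℝ × ℝ →L[ℝ] ℝ)
    (hfu : f u = 1) (hf : ∀ z, PP p z ≤ 1 → |f z| ≤ 1) (z : ℝ × ℝ) (hz : PP p z = 1)
    (hzu : z ≠ u) : f z < 1 := by
  by_contra h
  push Not at h
  have hm := PP_mid_lt p hp z u hzu hz hu
  have h1 := abs_le_NN p hp f 1 hf ((1 / 2 : ℝ) • (z + u))
  have h2 : NN p ((1 / 2 : ℝ) • (z + u)) < 1 := by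
    by_contra h3
    push Not at h3
    rw [one_le_NN p hp] at h3
    linarith
  have h3 : f ((1 / 2 : ℝ) • (z + u)) = (1 / 2) * (f z + 1) := by
    rw [map_smul, map_add, hfu]; simp
  rw [h3] at h1
  have := le_abs_self ((1 / 2) * (f z + 1))
  linarith

lemma PP_neg (p : ℝ) (z : ℝ × ℝ) : PP p (-z) = PP p z := by simp [PP]

lemma dual_abs_strict (p : ℝ) (hp : 1 < p) (u : ℝ × ℝ) (hu : PP p u = 1) (f : ℝ × ℝ →L[ℝ] ℝ)
    (hfu : f u = 1) (hf : ∀ z, PP p z ≤ 1 → |f z| ≤ 1) (z : ℝ × ℝ) (hz : PP p z = 1)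
    (hzu : z ≠ u) (hzu' : -z ≠ u) : -1 < f z ∧ f z < 1 := by
  refine ⟨?_, dual_strict p hp u hu f hfu hf z hz hzu⟩
  have := dual_strict p hp u hu f hfu hf (-z) (by rw [PP_neg, hz]) hzu'
  rw [map_neg] at this
  linarith

lemma hull_tri (C : Set (ℝ × ℝ)) (hC : Convex ℝ C) (a b : ℝ × ℝ) (ha : a ∈ C) (hb : b ∈ C)
    (h0 : (0 : ℝ × ℝ) ∈ C) (l m : ℝ) (hl : 0 ≤ l) (hm : 0 ≤ m) (hlm : l + m ≤ 1) :
    l • a + m • b ∈ C := by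
  rcases (add_nonneg hl hm).eq_or_lt with h | h
  · have h1 : l = 0 := by linarith
    have h2 : m = 0 := by linarith
    simpa [h1, h2] using h0
  · have h1 : (l / (l + m)) • a + (m / (l + m)) • b ∈ C :=
      hC ha hb (by positivity) (by positivity) (by field_simp)
    have h2 := hC h1 h0 h.le (by linarith : 0 ≤ 1 - (l + m)) (by ring)
    have e : (l + m) • ((l / (l + m)) • a + (m / (l + m)) • b) + (1 - (l + m)) • (0 : ℝ × ℝ)
        = l • a + m • b := by
      rw [smul_zero, add_zero, smul_add, smul_smul, smul_smul]
      congr 2 <;> field_simp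
    rwa [e] at h2

lemma cone_coords (x y xa ya xb yb : ℝ) (hD : 0 < xa * yb - ya * xb)
    (h1 : 0 ≤ xa * y - ya * x) (h2 : xb * y - yb * x ≤ 0) :
    ∃ l m : ℝ, 0 ≤ l ∧ 0 ≤ m ∧ x = l * xa + m * xb ∧ y = l * ya + m * yb := by
  refine ⟨-(xb * y - yb * x) / (xa * yb - ya * xb), (xa * y - ya * x) / (xa * yb - ya * xb),
    div_nonneg (by linarith) hD.le, div_nonneg h1 hD.le, ?_, ?_⟩
  · rw [div_mul_eq_mul_div, div_mul_eq_mul_div, ← add_div, eq_div_iff hD.ne']; ring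
  · rw [div_mul_eq_mul_div, div_mul_eq_mul_div, ← add_div, eq_div_iff hD.ne']; ring

lemma exists_coords (u v : ℝ × ℝ) (hD : crs u v ≠ 0) (z : ℝ × ℝ) :
    ∃ x y : ℝ, z = x • u + y • v := by
  refine ⟨crs z v / crs u v, crs u z / crs u v, ?_⟩
  ext
  · simp only [Prod.fst_add, Prod.smul_fst, smul_eq_mul]
    rw [div_mul_eq_mul_div, div_mul_eq_mul_div, ← add_div, eq_div_iff hD]; unfold crs; ring
  · simp only [Prod.snd_add, Prod.smul_snd, smul_eq_mul]
    rw [div_mul_eq_mul_div, div_mul_eq_mul_div, ← add_div, eq_div_iff hD]; unfold crs; ring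

/-- An abstract hexagon given by three strips is a hull of six points. -/
lemma hexagon_hull (f g h : ℝ × ℝ →L[ℝ] ℝ) (u v : ℝ × ℝ) (hD : crs u v ≠ 0) (α β s : ℝ)
    (hα : 0 < α) (hα1 : α < 1) (hβ : 0 < β) (hβ1 : β < 1) (hs : 0 < s) (hs1 : s < 1)
    (hfu : f u = 1) (hfv : f v = α) (hgu : g u = β) (hgv : g v = 1)
    (hhu : h u = -s) (hhv : h v = 1 - s) :
    ∃ a b c : ℝ × ℝ, convexHull ℝ ({a, b, c, -a, -b, -c} : Set (ℝ × ℝ)) =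
      {z | |f z| ≤ 1 ∧ |g z| ≤ 1 ∧ |h z| ≤ 1} := by
  have hd1 : 0 < 1 - α * β := by nlinarith
  have hd2 : 0 < β * (1 - s) + s := by nlinarith
  have hd3 : 0 < s * α + (1 - s) := by nlinarith
  obtain ⟨xa, hxa⟩ : ∃ xa, xa = (1 - α) / (1 - α * β) := ⟨_, rfl⟩
  obtain ⟨ya, hya⟩ : ∃ ya, ya = (1 - β) / (1 - α * β) := ⟨_, rfl⟩
  obtain ⟨xb, hxb⟩ : ∃ xb, xb = -s / (β * (1 - s) + s) := ⟨_, rfl⟩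
  obtain ⟨yb, hyb⟩ : ∃ yb, yb = (β + s) / (β * (1 - s) + s) := ⟨_, rfl⟩
  obtain ⟨xc, hxc⟩ : ∃ xc, xc = -(α + (1 - s)) / (s * α + (1 - s)) := ⟨_, rfl⟩
  obtain ⟨yc, hyc⟩ : ∃ yc, yc = (1 - s) / (s * α + (1 - s)) := ⟨_, rfl⟩
  have hf : ∀ x y : ℝ, f (x • u + y • v) = x + y * α := by
    intro x y; rw [map_add, map_smul, map_smul, hfu, hfv]; simp
  have hg : ∀ x y : ℝ, g (x • u + y • v) = x * β + y := by
    intro x y; rw [map_add, map_smul, map_smul, hgu, hgv]; simp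
  have hh : ∀ x y : ℝ, h (x • u + y • v) = -(x * s) + y * (1 - s) := by
    intro x y; rw [map_add, map_smul, map_smul, hhu, hhv]; simp
  have fa : xa + ya * α = 1 := by rw [hxa, hya]; field_simp; ring
  have ga : xa * β + ya = 1 := by rw [hxa, hya]; field_simp; ring
  have gb : xb * β + yb = 1 := by rw [hxb, hyb]; field_simp; ring
  have hb : -(xb * s) + yb * (1 - s) = 1 := by rw [hxb, hyb]; field_simp; ring
  have hc : -(xc * s) + yc * (1 - s) = 1 := by
    have e : -(xc * s) + yc * (1 - s) = (s * α + (1 - s)) / (s * α + (1 - s)) := by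
      rw [hxc, hyc]; ring
    rw [e, div_self hd3.ne']
  have fc : xc + yc * α = -1 := by
    have e : xc + yc * α = -((s * α + (1 - s)) / (s * α + (1 - s))) := by
      rw [hxc, hyc]; ring
    rw [e, div_self hd3.ne']
  have ha : |-(xa * s) + ya * (1 - s)| ≤ 1 := by
    have e : -(xa * s) + ya * (1 - s) = (-((1 - α) * s) + (1 - β) * (1 - s)) / (1 - α * β) := by
      rw [hxa, hya]; ring
    rw [e, abs_le, le_div_iff₀ hd1, div_le_iff₀ hd1]
    constructor
    · linarith [mul_pos hα (sub_pos.2 hβ1), mul_pos (sub_pos.2 hα1) (sub_pos.2 hs1), mul_pos (sub_pos.2 hβ1) (sub_pos.2 hs1)]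
    · linarith [mul_pos hβ (sub_pos.2 hα1), mul_pos (sub_pos.2 hβ1) hs, mul_pos (sub_pos.2 hα1) hs]
  have fb : |xb + yb * α| ≤ 1 := by
    have e : xb + yb * α = (-s + (β + s) * α) / (β * (1 - s) + s) := by
      rw [hxb, hyb]; ring
    rw [e, abs_le, le_div_iff₀ hd2, div_le_iff₀ hd2]
    constructor
    · linarith [mul_pos hβ (sub_pos.2 hs1), mul_pos hα hβ, mul_pos hs hα]
    · linarith [mul_pos hβ (sub_pos.2 hα1), mul_pos hs (sub_pos.2 hβ1), mul_pos hs (sub_pos.2 hα1)]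
  have gc : |xc * β + yc| ≤ 1 := by
    have e : xc * β + yc = (-(α + (1 - s)) * β + (1 - s)) / (s * α + (1 - s)) := by
      rw [hxc, hyc]; ring
    rw [e, abs_le, le_div_iff₀ hd3, div_le_iff₀ hd3]
    constructor
    · linarith [mul_pos (sub_pos.2 hs1) (sub_pos.2 hβ1), mul_pos (sub_pos.2 hs1) (sub_pos.2 hα1), mul_pos hα (sub_pos.2 hβ1)]
    · linarith [mul_pos hs hα, mul_pos hα hβ, mul_pos (sub_pos.2 hs1) hβ]
  have Dab : 0 < xa * yb - ya * xb := by
    have e : xa * yb - ya * xb = ((1 - α) * (β + s) + (1 - β) * s)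
        / ((1 - α * β) * (β * (1 - s) + s)) := by
      rw [hxa, hya, hxb, hyb]; field_simp; ring
    rw [e]
    apply div_pos _ (mul_pos hd1 hd2)
    have := sub_pos.2 hα1
    have := sub_pos.2 hβ1
    positivity
  have Dbc : 0 < xb * yc - yb * xc := by
    have e : xb * yc - yb * xc = (α * β + β * (1 - s) + s * α)
        / ((β * (1 - s) + s) * (s * α + (1 - s))) := by
      rw [hxb, hyb, hxc, hyc]; field_simp; ring
    rw [e]
    apply div_pos _ (mul_pos hd2 hd3)
    have := sub_pos.2 hs1
    positivity
  have Dca : 0 < xc * (-ya) - yc * (-xa) := by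
    have e : xc * (-ya) - yc * (-xa) = ((1 - α) * (1 - s) + (1 - β) * (α + (1 - s)))
        / ((1 - α * β) * (s * α + (1 - s))) := by
      rw [hxa, hya, hxc, hyc]; field_simp; ring
    rw [e]
    apply div_pos _ (mul_pos hd1 hd3)
    have := sub_pos.2 hα1
    have := sub_pos.2 hβ1
    have := sub_pos.2 hs1
    positivity
  clear hxa hya hxb hyb hxc hyc
  refine ⟨xa • u + ya • v, xb • u + yb • v, xc • u + yc • v, ?_⟩
  set a := xa • u + ya • v with hadef
  set b := xb • u + yb • v with hbdef
  set c := xc • u + yc • v with hcdef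
  set C := convexHull ℝ ({a, b, c, -a, -b, -c} : Set (ℝ × ℝ)) with hCdef
  have hCc : Convex ℝ C := convex_convexHull _ _
  have hsub := subset_convexHull ℝ ({a, b, c, -a, -b, -c} : Set (ℝ × ℝ))
  have ma : a ∈ C := hsub (by simp)
  have mb : b ∈ C := hsub (by simp)
  have mc : c ∈ C := hsub (by simp)
  have ma' : -a ∈ C := hsub (by simp)
  have mb' : -b ∈ C := hsub (by simp)
  have mc' : -c ∈ C := hsub (by simp)
  have m0 : (0 : ℝ × ℝ) ∈ C := by
    have := hCc ma ma' (by norm_num : (0:ℝ) ≤ 1/2) (by norm_num : (0:ℝ) ≤ 1/2) (by norm_num)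
    simpa using this
  apply Set.Subset.antisymm
  · apply convexHull_min
    · intro z hz
      simp only [Set.mem_insert_iff, Set.mem_singleton_iff] at hz
      have va : |f a| ≤ 1 ∧ |g a| ≤ 1 ∧ |h a| ≤ 1 := by
        rw [hadef, hf, hg, hh, fa, ga]; simp [ha]
      have vb : |f b| ≤ 1 ∧ |g b| ≤ 1 ∧ |h b| ≤ 1 := by
        rw [hbdef, hf, hg, hh, gb, hb]; simp [fb]
      have vc : |f c| ≤ 1 ∧ |g c| ≤ 1 ∧ |h c| ≤ 1 := by
        rw [hcdef, hf, hg, hh, fc, hc]; simp [gc]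
      rcases hz with rfl | rfl | rfl | rfl | rfl | rfl <;>
        simpa only [Set.mem_ofPred_eq, map_neg, abs_neg]
    · have hc1 : ∀ k : ℝ × ℝ →L[ℝ] ℝ, Convex ℝ {z | |k z| ≤ 1} := fun k => strip_convex k 1
      exact (hc1 f).inter ((hc1 g).inter (hc1 h))
  · have key : ∀ x y : ℝ, 0 ≤ xa * y - ya * x → |f (x • u + y • v)| ≤ 1 →
        |g (x • u + y • v)| ≤ 1 → |h (x • u + y • v)| ≤ 1 →
        x • u + y • v ∈ C ∧ -(x • u + y • v) ∈ C := by
      intro x y hx h1 h2 h3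
      rw [hf] at h1
      rw [hg] at h2
      rw [hh] at h3
      rcases le_total (xb * y - yb * x) 0 with h4 | h4
      · obtain ⟨l, m, hl, hm, ex, ey⟩ := cone_coords x y xa ya xb yb Dab hx h4
        have e : x • u + y • v = l • a + m • b := by rw [ex, ey, hadef, hbdef]; module
        have e' : -(x • u + y • v) = l • (-a) + m • (-b) := by rw [e]; module
        have hlm : l + m ≤ 1 := by
          have : x * β + y = l + m := by rw [ex, ey]; linear_combination l * ga + m * gb
          rw [← this]; exact (abs_le.1 h2).2
        rw [e', e]
        exact ⟨hull_tri C hCc _ _ ma mb m0 l m hl hm hlm,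
          hull_tri C hCc _ _ ma' mb' m0 l m hl hm hlm⟩
      · rcases le_total (xc * y - yc * x) 0 with h5 | h5
        · obtain ⟨l, m, hl, hm, ex, ey⟩ := cone_coords x y xb yb xc yc Dbc h4 h5
          have e : x • u + y • v = l • b + m • c := by rw [ex, ey, hbdef, hcdef]; module
          have e' : -(x • u + y • v) = l • (-b) + m • (-c) := by rw [e]; module
          have hlm : l + m ≤ 1 := by
            have : -(x * s) + y * (1 - s) = l + m := by
              rw [ex, ey]; linear_combination l * hb + m * hc
            rw [← this]; exact (abs_le.1 h3).2
          rw [e', e]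
          exact ⟨hull_tri C hCc _ _ mb mc m0 l m hl hm hlm,
            hull_tri C hCc _ _ mb' mc' m0 l m hl hm hlm⟩
        · obtain ⟨l, m, hl, hm, ex, ey⟩ := cone_coords x y xc yc (-xa) (-ya) Dca h5
            (by linarith)
          have e : x • u + y • v = l • c + m • (-a) := by rw [ex, ey, hadef, hcdef]; module
          have e' : -(x • u + y • v) = l • (-c) + m • a := by rw [e]; module
          have hlm : l + m ≤ 1 := by
            have : x + y * α = -(l + m) := by
              rw [ex, ey]; linear_combination l * fc - m * fa
            have := (abs_le.1 h1).1
            linarith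
          rw [e', e]
          exact ⟨hull_tri C hCc _ _ mc ma' m0 l m hl hm hlm,
            hull_tri C hCc _ _ mc' ma m0 l m hl hm hlm⟩
    rintro z ⟨h1, h2, h3⟩
    obtain ⟨x, y, rfl⟩ := exists_coords u v hD z
    rcases le_total 0 (xa * y - ya * x) with hx | hx
    · exact (key x y hx h1 h2 h3).1
    · have e : (-x) • u + (-y) • v = -(x • u + y • v) := by module
      have := (key (-x) (-y) (by linarith) (by rw [e, map_neg, abs_neg]; exact h1)
        (by rw [e, map_neg, abs_neg]; exact h2) (by rw [e, map_neg, abs_neg]; exact h3)).2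
      rwa [e, neg_neg] at this


lemma not_mem_interior (C : Set (ℝ × ℝ)) (f : ℝ × ℝ →L[ℝ] ℝ) (hf : ∀ z ∈ C, |f z| ≤ 1)
    (q : ℝ × ℝ) (hq : 1 ≤ |f q|) : q ∉ interior C := by
  intro hin
  have hc : Continuous (fun t : ℝ => t • q) := by fun_prop
  have h1 : (fun t : ℝ => t • q) ⁻¹' (interior C) ∈ nhds (1 : ℝ) := by
    apply hc.continuousAt.preimage_mem_nhds
    simpa using isOpen_interior.mem_nhds hin
  obtain ⟨e, he, hb⟩ := Metric.mem_nhds_iff.1 h1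
  have h2 : (1 + e / 2) ∈ Metric.ball (1 : ℝ) e := by
    rw [Metric.mem_ball, Real.dist_eq]
    rw [show 1 + e / 2 - 1 = e / 2 by ring, abs_of_pos (by positivity)]; linarith
  have h3 : (1 + e / 2) • q ∈ C := interior_subset (hb h2)
  have h4 := hf _ h3
  rw [map_smul, smul_eq_mul, abs_mul, abs_of_pos (by positivity)] at h4
  nlinarith

open MeasureTheory in
lemma volume_le_of_no_lattice (u v : ℝ × ℝ) (hD : crs u v ≠ 0) (C : Set (ℝ × ℝ))
    (hC : Convex ℝ C) (hsym : ∀ x ∈ C, -x ∈ C)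
    (hno : ∀ m k : ℤ, (m ≠ 0 ∨ k ≠ 0) → (m : ℝ) • u + (k : ℝ) • v ∉ interior C) :
    volume C ≤ ENNReal.ofReal (4 * |crs u v|) := by
  have hli : LinearIndependent ℝ ![u, v] := by
    rw [LinearIndependent.pair_iff]
    intro s t h
    have h1 : s * u.1 + t * v.1 = 0 := by simpa using congrArg Prod.fst h
    have h2 : s * u.2 + t * v.2 = 0 := by simpa using congrArg Prod.snd h
    have h3 : s * crs u v = 0 := by unfold crs; linear_combination h1 * v.2 - h2 * v.1
    have h4 : t * crs u v = 0 := by unfold crs; linear_combination h2 * u.1 - h1 * u.2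
    exact ⟨by simpa [hD] using h3, by simpa [hD] using h4⟩
  let b : Module.Basis (Fin 2) ℝ (ℝ × ℝ) := basisOfLinearIndependentOfCardEqFinrank hli (by simp)
  have hb : (b : Fin 2 → ℝ × ℝ) = ![u, v] := by simp [b]
  have hF0 : volume (ZSpan.fundamentalDomain (Module.Basis.finTwoProd ℝ)) = 1 := by
    have : ZSpan.fundamentalDomain (Module.Basis.finTwoProd ℝ)
        = Set.Ico (0 : ℝ) 1 ×ˢ Set.Ico (0 : ℝ) 1 := by
      ext z
      rw [ZSpan.mem_fundamentalDomain, Fin.forall_fin_two]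
      simp [Set.mem_prod]
    rw [this, Measure.volume_eq_prod, Measure.prod_prod]
    simp
  have hF : volume (ZSpan.fundamentalDomain b) = ENNReal.ofReal |crs u v| := by
    rw [ZSpan.measure_fundamentalDomain b volume (Module.Basis.finTwoProd ℝ), hF0, mul_one, hb]
    congr 2
    rw [Module.Basis.det_apply, Matrix.det_fin_two]
    simp [Module.Basis.toMatrix_apply, crs]
    ring
  have hvolint : volume C = volume (interior C) := by
    apply le_antisymm _ (measure_mono interior_subset)
    calc volume C ≤ volume (interior C ∪ frontier C) := by
          apply measure_mono
          rw [← closure_eq_interior_union_frontier]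
          exact subset_closure
      _ ≤ volume (interior C) + volume (frontier C) := measure_union_le _ _
      _ = volume (interior C) := by rw [hC.addHaar_frontier volume, add_zero]
  rw [hvolint]
  by_contra hlt
  push Not at hlt
  have hlt' : volume (ZSpan.fundamentalDomain b) * 2 ^ Module.finrank ℝ (ℝ × ℝ)
      < volume (interior C) := by
    rw [hF]
    convert hlt using 1
    rw [ENNReal.ofReal_mul (by norm_num), mul_comm]
    congr 1
    simp
    norm_num
  have hcount : Countable (Submodule.span ℤ (Set.range b)).toAddSubgroup :=
    inferInstanceAs (Countable (Submodule.span ℤ (Set.range b)))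
  have hsymi : ∀ x ∈ interior C, -x ∈ interior C := by
    intro x hx
    have hCn : -C = C := by
      ext y
      rw [Set.mem_neg]
      exact ⟨fun h => by simpa using hsym _ h, fun h => hsym _ h⟩
    have := (Homeomorph.neg (ℝ × ℝ)).image_interior C
    have h2 : -x ∈ (Homeomorph.neg (ℝ × ℝ)) '' interior C := ⟨x, hx, rfl⟩
    rw [this] at h2
    convert h2 using 2
    rw [← hCn]
    ext y
    simp
    exact ⟨fun h => by simpa using hsym _ h, hsym y⟩
  obtain ⟨x, hx0, hx⟩ := exists_ne_zero_mem_lattice_of_measure_mul_two_pow_lt_measure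
    (ZSpan.isAddFundamentalDomain' b volume) (s := interior C) hsymi hC.interior hlt'
  · obtain ⟨x, hxL⟩ := x
    have hxL' : x ∈ Submodule.span ℤ (Set.range b) := hxL
    rw [hb] at hxL'
    have : Set.range ![u, v] = {u, v} := by simp [Set.pair_comm]
    rw [this, Submodule.mem_span_pair] at hxL'
    obtain ⟨m, k, rfl⟩ := hxL'
    refine hno m k ?_ ?_
    · by_contra h
      push Not at h
      apply hx0
      simp [h.1, h.2]
    · simpa [Int.cast_smul_eq_zsmul] using hx

/-- The set of hexagon areas. -/
def hexSet (p : ℝ) : Set ℝ := {A : ℝ | ∃ a b c : ℝ × ℝ,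
        (∀ z : ℝ × ℝ, |z.1| ^ p + |z.2| ^ p ≤ 1 →
            z ∈ convexHull ℝ ({a, b, c, -a, -b, -c} : Set (ℝ × ℝ))) ∧
        (∃ q₁ q₂ q₃ : ℝ × ℝ,
            ({q₁, q₂, q₃, -q₁, -q₂, -q₃} : Set (ℝ × ℝ)).ncard = 6 ∧
            ∀ q ∈ ({q₁, q₂, q₃, -q₁, -q₂, -q₃} : Set (ℝ × ℝ)),
              q ∈ frontier (convexHull ℝ ({a, b, c, -a, -b, -c} : Set (ℝ × ℝ))) ∧
              |q.1| ^ p + |q.2| ^ p = 1) ∧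
        A = (MeasureTheory.volume
            (convexHull ℝ ({a, b, c, -a, -b, -c} : Set (ℝ × ℝ)))).toReal}

lemma ncard_six (u v : ℝ × ℝ) (hD : crs u v ≠ 0) :
    ({u, v, v - u, -u, -v, -(v - u)} : Set (ℝ × ℝ)).ncard = 6 := by
  have key : ∀ x y : ℝ, x • u + y • v = 0 → x = 0 ∧ y = 0 := by
    intro s t h
    have h1 : s * u.1 + t * v.1 = 0 := by simpa using congrArg Prod.fst h
    have h2 : s * u.2 + t * v.2 = 0 := by simpa using congrArg Prod.snd h
    have h3 : s * crs u v = 0 := by unfold crs; linear_combination h1 * v.2 - h2 * v.1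
    have h4 : t * crs u v = 0 := by unfold crs; linear_combination h2 * u.1 - h1 * u.2
    exact ⟨by simpa [hD] using h3, by simpa [hD] using h4⟩
  have ne : ∀ (a b : ℝ × ℝ) (x y : ℝ), a - b = x • u + y • v → (x ≠ 0 ∨ y ≠ 0) → a ≠ b := by
    intro a b x y h1 h2 h3
    rw [h3, sub_self] at h1
    have := key x y h1.symm
    tauto
  have h1 : u ≠ v := ne _ _ 1 (-1) (by module) (by norm_num)
  have h2 : u ≠ v - u := ne _ _ 2 (-1) (by module) (by norm_num)
  have h3 : u ≠ -u := ne _ _ 2 0 (by module) (by norm_num)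
  have h4 : u ≠ -v := ne _ _ 1 1 (by module) (by norm_num)
  have h5 : u ≠ -(v - u) := ne _ _ 0 1 (by module) (by norm_num)
  have h6 : v ≠ v - u := ne _ _ 1 0 (by module) (by norm_num)
  have h7 : v ≠ -u := ne _ _ 1 1 (by module) (by norm_num)
  have h8 : v ≠ -v := ne _ _ 0 2 (by module) (by norm_num)
  have h9 : v ≠ -(v - u) := ne _ _ (-1) 2 (by module) (by norm_num)
  have h10 : v - u ≠ -u := ne _ _ 0 1 (by module) (by norm_num)
  have h11 : v - u ≠ -v := ne _ _ (-1) 2 (by module) (by norm_num)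
  have h12 : v - u ≠ -(v - u) := ne _ _ (-2) 2 (by module) (by norm_num)
  have h13 : -u ≠ -v := ne _ _ (-1) 1 (by module) (by norm_num)
  have h14 : -u ≠ -(v - u) := ne _ _ (-2) 1 (by module) (by norm_num)
  have h15 : -v ≠ -(v - u) := ne _ _ (-1) 0 (by module) (by norm_num)
  rw [Set.ncard_insert_of_notMem, Set.ncard_insert_of_notMem, Set.ncard_insert_of_notMem,
    Set.ncard_insert_of_notMem, Set.ncard_insert_of_notMem, Set.ncard_singleton]
  all_goals
    simp only [Set.mem_insert_iff, Set.mem_singleton_iff, not_or]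
    try tauto

lemma exists_hex (p : ℝ) (hp : 1 < p) (x y : ℝ × ℝ) (hx : NN p x = 1) (hy : NN p y = 1)
    (hxy : NN p (y - x) = 1) (hD : crs x y ≠ 0) :
    ∃ A ∈ hexSet p, A ≤ 4 * |crs x y| := by
  rw [NN_eq_one p hp] at hx hy hxy
  have hns : ∀ s t : ℝ, s ≠ 0 ∨ t ≠ 0 → s • x + t • y ≠ 0 := by
    intro s t hst h
    have h1 : s * x.1 + t * y.1 = 0 := by simpa using congrArg Prod.fst h
    have h2 : s * x.2 + t * y.2 = 0 := by simpa using congrArg Prod.snd h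
    have h3 : s * crs x y = 0 := by unfold crs; linear_combination h1 * y.2 - h2 * y.1
    have h4 : t * crs x y = 0 := by unfold crs; linear_combination h2 * x.1 - h1 * x.2
    have h5 : s = 0 := by simpa [hD] using h3
    have h6 : t = 0 := by simpa [hD] using h4
    tauto
  have ne : ∀ (a b : ℝ × ℝ) (s t : ℝ), a - b = s • x + t • y → (s ≠ 0 ∨ t ≠ 0) → a ≠ b := by
    intro a b s t h1 h2 h3
    rw [h3, sub_self] at h1
    exact hns s t h2 h1.symm
  obtain ⟨f, hf1, hf⟩ := exists_dual p hp x hx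
  obtain ⟨g, hg1, hg⟩ := exists_dual p hp y hy
  obtain ⟨h, hh1, hh⟩ := exists_dual p hp (y - x) hxy
  have f1 := dual_abs_strict p hp x hx f hf1 hf y hy
    (ne _ _ (-1) 1 (by module) (by norm_num)) (ne _ _ (-1) (-1) (by module) (by norm_num))
  have f2 := dual_abs_strict p hp x hx f hf1 hf (y - x) hxy
    (ne _ _ (-2) 1 (by module) (by norm_num)) (ne _ _ 0 (-1) (by module) (by norm_num))
  have g1 := dual_abs_strict p hp y hy g hg1 hg x hx
    (ne _ _ 1 (-1) (by module) (by norm_num)) (ne _ _ (-1) (-1) (by module) (by norm_num))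
  have g2 := dual_abs_strict p hp y hy g hg1 hg (y - x) hxy
    (ne _ _ (-1) 0 (by module) (by norm_num)) (ne _ _ 1 (-2) (by module) (by norm_num))
  have k1 := dual_abs_strict p hp _ hxy h hh1 hh x hx
    (ne _ _ 2 (-1) (by module) (by norm_num)) (ne _ _ 0 (-1) (by module) (by norm_num))
  have k2 := dual_abs_strict p hp _ hxy h hh1 hh y hy
    (ne _ _ 1 0 (by module) (by norm_num)) (ne _ _ 1 (-2) (by module) (by norm_num))
  rw [map_sub] at f2 g2 hh1
  rw [hf1] at f2
  rw [hg1] at g2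
  obtain ⟨a, b, c, hC⟩ := hexagon_hull f g h x y hD (f y) (g x) (-h x) (by linarith)
    (by linarith) (by linarith) (by linarith) (by linarith) (by linarith) hf1 rfl rfl hg1
    (by ring) (by linarith)
  set C := convexHull ℝ ({a, b, c, -a, -b, -c} : Set (ℝ × ℝ)) with hCdef
  have hCf : ∀ z ∈ C, |f z| ≤ 1 := fun z hz => by rw [hC] at hz; exact hz.1
  have hCg : ∀ z ∈ C, |g z| ≤ 1 := fun z hz => by rw [hC] at hz; exact hz.2.1
  have hCh : ∀ z ∈ C, |h z| ≤ 1 := fun z hz => by rw [hC] at hz; exact hz.2.2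
  have hK : ∀ z, PP p z ≤ 1 → z ∈ C := by
    intro z hz
    rw [hC]
    exact ⟨hf z hz, hg z hz, hh z hz⟩
  have hvol : MeasureTheory.volume C ≤ ENNReal.ofReal (4 * |crs x y|) := by
    apply volume_le_of_no_lattice x y hD C (convex_convexHull _ _)
    · intro z hz
      rw [hC] at hz ⊢
      simpa only [Set.mem_ofPred_eq, map_neg, abs_neg] using hz
    · intro m k hmk
      have ef : f ((m : ℝ) • x + (k : ℝ) • y) = m + k * f y := by
        rw [map_add, map_smul, map_smul, hf1]; simp
      have eg : g ((m : ℝ) • x + (k : ℝ) • y) = m * g x + k := by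
        rw [map_add, map_smul, map_smul, hg1]; simp
      have eh : h ((m : ℝ) • x + (k : ℝ) • y) = m * h x + k * (1 + h x) := by
        rw [map_add, map_smul, map_smul]; simp; left; linarith
      have hmz : m ≤ -1 ∨ m = 0 ∨ 1 ≤ m := by omega
      have hkz : k ≤ -1 ∨ k = 0 ∨ 1 ≤ k := by omega
      have cast1 : ∀ n : ℤ, 1 ≤ n → (1 : ℝ) ≤ n := fun n hn => by exact_mod_cast hn
      have cast2 : ∀ n : ℤ, n ≤ -1 → (n : ℝ) ≤ -1 := fun n hn => by exact_mod_cast hn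
      rcases hmz with hm | hm | hm
      · have hm' := cast2 m hm
        rcases hkz with hk | hk | hk
        · have hk' := cast2 k hk
          apply not_mem_interior C f hCf
          rw [ef, le_abs]; right; nlinarith
        · apply not_mem_interior C f hCf
          rw [ef, le_abs]; right; rw [hk]; push_cast; linarith
        · have hk' := cast1 k hk
          apply not_mem_interior C h hCh
          rw [eh, le_abs]; left; nlinarith
      · have hk0 : k ≠ 0 := by tauto
        apply not_mem_interior C g hCg
        rw [eg, hm, le_abs]
        rcases hkz with hk | hk | hk
        · have hk' := cast2 k hk
          right; push_cast; linarith
        · exact absurd hk hk0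
        · have hk' := cast1 k hk
          left; push_cast; linarith
      · have hm' := cast1 m hm
        rcases hkz with hk | hk | hk
        · have hk' := cast2 k hk
          apply not_mem_interior C h hCh
          rw [eh, le_abs]; right; nlinarith
        · apply not_mem_interior C f hCf
          rw [ef, le_abs]; left; rw [hk]; push_cast; linarith
        · have hk' := cast1 k hk
          apply not_mem_interior C f hCf
          rw [ef, le_abs]; left; nlinarith
  refine ⟨(MeasureTheory.volume C).toReal, ⟨a, b, c, hK, ⟨x, y, y - x, ncard_six x y hD, ?_⟩, rfl⟩,
    ?_⟩
  · have hfr : ∀ (k : ℝ × ℝ →L[ℝ] ℝ) (q : ℝ × ℝ), (∀ z ∈ C, |k z| ≤ 1) → k q = 1 → PP p q = 1 →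
        (q ∈ frontier C ∧ |q.1| ^ p + |q.2| ^ p = 1) ∧
        (-q ∈ frontier C ∧ |(-q).1| ^ p + |(-q).2| ^ p = 1) := by
      intro k q hk hkq hq
      have hq' : PP p (-q) = 1 := by rw [PP_neg, hq]
      exact ⟨⟨⟨subset_closure (hK q hq.le), not_mem_interior C k hk q (by rw [hkq]; simp)⟩, hq⟩,
        ⟨⟨subset_closure (hK _ hq'.le), not_mem_interior C k hk _ (by rw [map_neg, hkq]; simp)⟩,
          hq'⟩⟩
    have r1 := hfr f x hCf hf1 hx
    have r2 := hfr g y hCg hg1 hy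
    have r3 := hfr h (y - x) hCh (by rw [map_sub]; exact hh1) hxy
    intro q hq
    simp only [Set.mem_insert_iff, Set.mem_singleton_iff] at hq
    rcases hq with rfl | rfl | rfl | rfl | rfl | rfl
    · exact r1.1
    · exact r2.1
    · exact r3.1
    · exact r1.2
    · exact r2.2
    · exact r3.2
  · exact ENNReal.toReal_le_of_le_ofReal (by positivity) hvol


/-- The cross product with a fixed vector as a functional. -/
def crsL (w : ℝ × ℝ) : ℝ × ℝ →L[ℝ] ℝ :=
  w.1 • ContinuousLinearMap.snd ℝ ℝ ℝ - w.2 • ContinuousLinearMap.fst ℝ ℝ ℝ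

lemma crsL_apply (w z : ℝ × ℝ) : crsL w z = crs w z := by simp [crsL, crs]

/-- An open triangle with vertices `0`, `p`, `q`. -/
def TriO (p q : ℝ × ℝ) : Set (ℝ × ℝ) :=
  {z | 0 < crs z q ∧ 0 < crs p z ∧ crs z q + crs p z < crs p q}

lemma TriO_open (p q : ℝ × ℝ) : IsOpen (TriO p q) := by
  have h1 : Continuous (fun z => crs z q) := by unfold crs; fun_prop
  have h2 : Continuous (fun z => crs p z) := by unfold crs; fun_prop
  exact (isOpen_lt continuous_const h1).inter ((isOpen_lt continuous_const h2).inter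
    (isOpen_lt (h1.add h2) continuous_const))

open MeasureTheory in
lemma std_volume : volume {z : ℝ × ℝ | 0 < z.1 ∧ 0 < z.2 ∧ z.1 + z.2 < 1}
    = ENNReal.ofReal (1 / 2) := by
  have e : {z : ℝ × ℝ | 0 < z.1 ∧ 0 < z.2 ∧ z.1 + z.2 < 1}
      = regionBetween (fun _ => (0 : ℝ)) (fun x => 1 - x) (Set.Ioo 0 1) := by
    ext z
    simp only [regionBetween, Set.mem_ofPred_eq, Set.mem_Ioo]
    constructor
    · rintro ⟨h1, h2, h3⟩
      exact ⟨⟨h1, by linarith⟩, h2, by linarith⟩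
    · rintro ⟨⟨h1, h2⟩, h3, h4⟩
      exact ⟨h1, h3, by linarith⟩
  rw [e, Measure.volume_eq_prod, volume_regionBetween_eq_integral]
  · congr 1
    rw [← integral_Ioc_eq_integral_Ioo, ← intervalIntegral.integral_of_le zero_le_one]
    have e2 : ((fun x : ℝ => 1 - x) - fun _ => (0 : ℝ)) = fun x => 1 - x := by
      ext x; simp
    rw [e2, intervalIntegral.integral_sub (by simp) (by simp), integral_id]
    simp
    norm_num
  · exact integrableOn_zero
  · exact (Continuous.integrableOn_Icc (by fun_prop)).mono_set Set.Ioo_subset_Icc_self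
  · exact measurableSet_Ioo
  · intro x hx
    simp only [Set.mem_Ioo] at hx
    simp; linarith

open MeasureTheory in
lemma TriO_volume (p q : ℝ × ℝ) : ENNReal.ofReal (crs p q / 2) ≤ volume (TriO p q) := by
  rcases le_or_gt (crs p q) 0 with h | h
  · rw [ENNReal.ofReal_of_nonpos (by linarith)]; exact zero_le
  let L : ℝ × ℝ →ₗ[ℝ] ℝ × ℝ :=
    Matrix.toLin (Module.Basis.finTwoProd ℝ) (Module.Basis.finTwoProd ℝ) !![p.1, q.1; p.2, q.2]
  have hL : ∀ z, L z = (p.1 * z.1 + q.1 * z.2, p.2 * z.1 + q.2 * z.2) := fun z =>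
    Matrix.toLin_finTwoProd_apply _ _ _ _ z
  have hdet : LinearMap.det L = crs p q := by
    simp only [L, LinearMap.det_toLin, Matrix.det_fin_two_of, crs]; ring
  have hsub : L '' {z : ℝ × ℝ | 0 < z.1 ∧ 0 < z.2 ∧ z.1 + z.2 < 1} ⊆ TriO p q := by
    rintro _ ⟨z, ⟨h1, h2, h3⟩, rfl⟩
    have e1 : crs (L z) q = z.1 * crs p q := by rw [hL]; simp only [crs]; ring
    have e2 : crs p (L z) = z.2 * crs p q := by rw [hL]; simp only [crs]; ring
    refine ⟨?_, ?_, ?_⟩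
    · rw [e1]; positivity
    · rw [e2]; positivity
    · rw [e1, e2]; nlinarith
  refine le_trans (le_of_eq ?_) (measure_mono hsub)
  rw [Measure.addHaar_image_linearMap, hdet, std_volume, abs_of_pos h,
    ← ENNReal.ofReal_mul h.le]
  congr 1; ring

lemma TriO_subset (C : Set (ℝ × ℝ)) (hC : Convex ℝ C) (p q : ℝ × ℝ) (hp : p ∈ C) (hq : q ∈ C)
    (h0 : (0 : ℝ × ℝ) ∈ C) : TriO p q ⊆ C := by
  rintro z ⟨h1, h2, h3⟩
  have hD : 0 < crs p q := by linarith
  have := hull_tri C hC p q hp hq h0 (crs z q / crs p q) (crs p z / crs p q)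
    (by positivity) (by positivity) (by rw [← add_div, div_le_one hD]; exact h3.le)
  convert this using 1
  ext
  · simp only [Prod.fst_add, Prod.smul_fst, smul_eq_mul]
    rw [div_mul_eq_mul_div, div_mul_eq_mul_div, ← add_div, eq_div_iff hD.ne']; unfold crs; ring
  · simp only [Prod.snd_add, Prod.smul_snd, smul_eq_mul]
    rw [div_mul_eq_mul_div, div_mul_eq_mul_div, ← add_div, eq_div_iff hD.ne']; unfold crs; ring

open MeasureTheory in
lemma hull_volume_ge (a b c : ℝ × ℝ) (hX : 0 ≤ crs b c) (hY : 0 ≤ crs c a) (hZ : 0 ≤ crs a b) :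
    crs b c + crs c a + crs a b ≤
      (volume (convexHull ℝ ({a, b, c, -a, -b, -c} : Set (ℝ × ℝ)))).toReal := by
  set C := convexHull ℝ ({a, b, c, -a, -b, -c} : Set (ℝ × ℝ)) with hCdef
  have hCc : Convex ℝ C := convex_convexHull _ _
  have hsub := subset_convexHull ℝ ({a, b, c, -a, -b, -c} : Set (ℝ × ℝ))
  have ma : a ∈ C := hsub (by simp)
  have mb : b ∈ C := hsub (by simp)
  have mc : c ∈ C := hsub (by simp)
  have ma' : -a ∈ C := hsub (by simp)
  have mb' : -b ∈ C := hsub (by simp)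
  have mc' : -c ∈ C := hsub (by simp)
  have m0 : (0 : ℝ × ℝ) ∈ C := by
    have := hCc ma ma' (by norm_num : (0:ℝ) ≤ 1/2) (by norm_num : (0:ℝ) ≤ 1/2) (by norm_num)
    simpa using this
  have hfin : volume C ≠ ⊤ := by
    have : IsCompact C := Set.Finite.isCompact_convexHull ℝ (Set.toFinite _)
    exact this.measure_lt_top.ne
  have rel : ∀ z, crs b c * crs a z + crs c a * crs b z + crs a b * crs c z = 0 := by
    intro z; unfold crs; ring
  have s1 : ∀ z w : ℝ × ℝ, crs z (-w) = crs w z := by intro z w; simp [crs]; ring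
  have s2 : ∀ z w : ℝ × ℝ, crs (-w) z = - crs w z := by intro z w; simp [crs]; ring
  have s3 : ∀ z w : ℝ × ℝ, crs z w = - crs w z := by intro z w; simp [crs]; ring
  have t1 : ∀ z, z ∈ TriO a (-c) → 0 < crs c z ∧ 0 < crs a z ∧ 0 < crs c a := by
    rintro z ⟨h1, h2, h3⟩
    rw [s1] at h1 h3
    rw [s1] at h3
    exact ⟨h1, h2, by linarith⟩
  have t2 : ∀ z, z ∈ TriO (-c) b → crs b z < 0 ∧ crs c z < 0 ∧ 0 < crs b c := by
    rintro z ⟨h1, h2, h3⟩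
    rw [s3 z b, s2, s2, s3 c b] at h3
    rw [s3 z b] at h1
    rw [s2] at h2
    exact ⟨by linarith, by linarith, by linarith⟩
  have t3 : ∀ z, z ∈ TriO b (-a) → 0 < crs a z ∧ 0 < crs b z ∧ 0 < crs a b := by
    rintro z ⟨h1, h2, h3⟩
    rw [s1] at h1 h3
    rw [s1] at h3
    exact ⟨h1, h2, by linarith⟩
  have d12 : Disjoint (TriO a (-c)) (TriO (-c) b) := by
    rw [Set.disjoint_left]
    intro z h1 h2
    have := t1 z h1
    have := t2 z h2
    linarith
  have d123 : Disjoint (TriO a (-c) ∪ TriO (-c) b) (TriO b (-a)) := by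
    rw [Set.disjoint_left]
    intro z h1 h3
    have q3 := t3 z h3
    rcases h1 with h1 | h1
    · have q1 := t1 z h1
      have := rel z
      have := mul_nonneg hX q1.2.1.le
      have := mul_nonneg hZ q1.1.le
      have := mul_pos q1.2.2 q3.2.1
      linarith
    · have := t2 z h1
      linarith
  set U := (TriO a (-c) ∪ TriO (-c) b) ∪ TriO b (-a) with hU
  have hUo : IsOpen U := ((TriO_open _ _).union (TriO_open _ _)).union (TriO_open _ _)
  have hUC : U ⊆ C := Set.union_subset (Set.union_subset (TriO_subset C hCc _ _ ma mc' m0)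
    (TriO_subset C hCc _ _ mc' mb m0)) (TriO_subset C hCc _ _ mb ma' m0)
  have hUC' : -U ⊆ C := by
    have hCn : ∀ z ∈ C, -z ∈ C := by
      intro z hz
      have h1 : -z ∈ -C := by simpa using hz
      rw [hCdef, ← convexHull_neg] at h1
      have e : -({a, b, c, -a, -b, -c} : Set (ℝ × ℝ)) = {a, b, c, -a, -b, -c} := by
        ext y
        simp only [Set.mem_neg, Set.mem_insert_iff, Set.mem_singleton_iff, neg_eq_iff_eq_neg,
          neg_neg]
        tauto
      rwa [e] at h1
    intro z hz
    have := hCn _ (hUC hz)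
    simpa using this
  have hUvol : ENNReal.ofReal ((crs b c + crs c a + crs a b) / 2) ≤ volume U := by
    rw [hU, measure_union d123 (TriO_open _ _).measurableSet,
      measure_union d12 (TriO_open _ _).measurableSet]
    have v1 := TriO_volume a (-c)
    have v2 := TriO_volume (-c) b
    have v3 := TriO_volume b (-a)
    rw [s1] at v1 v3
    rw [s2, s3 c b, neg_neg] at v2
    rw [show (crs b c + crs c a + crs a b) / 2 = crs c a / 2 + crs b c / 2 + crs a b / 2 by ring,
      ENNReal.ofReal_add (by positivity) (by positivity),
      ENNReal.ofReal_add (by positivity) (by positivity)]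
    gcongr
  have hdisj : Disjoint U (-U) := by
    rw [Set.disjoint_left]
    intro z h1 h2
    have n : ∀ w : ℝ × ℝ, crs w (-z) = - crs w z := by intro w; simp [crs]; ring
    rw [Set.mem_neg] at h2
    have r := rel z
    rcases h1 with (h1 | h1) | h1 <;> rcases h2 with (h2 | h2) | h2
    · have := t1 _ h1; have := t1 _ h2; rw [n, n] at this; linarith
    · have q := t1 _ h1
      have q' := t2 _ h2
      rw [n, n] at q'
      have := mul_nonneg hX q.2.1.le
      have := mul_nonneg hZ q.1.le
      have := mul_pos q.2.2 (by linarith : 0 < crs b z)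
      linarith
    · have := t1 _ h1; have := t3 _ h2; rw [n, n] at this; linarith
    · have q := t2 _ h1
      have q' := t1 _ h2
      rw [n, n] at q'
      have := mul_nonneg hY (by linarith : 0 ≤ -crs b z)
      have := mul_nonneg hZ (by linarith : 0 ≤ -crs c z)
      have := mul_pos q.2.2 (by linarith : 0 < -crs a z)
      linarith
    · have := t2 _ h1; have := t2 _ h2; rw [n, n] at this; linarith
    · have q := t2 _ h1
      have q' := t3 _ h2
      rw [n, n] at q'
      have := mul_nonneg hY (by linarith : 0 ≤ -crs b z)
      have := mul_nonneg hZ (by linarith : 0 ≤ -crs c z)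
      have := mul_pos q.2.2 (by linarith : 0 < -crs a z)
      linarith
    · have := t3 _ h1; have := t1 _ h2; rw [n, n] at this; linarith
    · have q := t3 _ h1
      have q' := t2 _ h2
      rw [n, n] at q'
      have := mul_nonneg hY (by linarith : 0 ≤ crs b z)
      have := mul_nonneg hX (by linarith : 0 ≤ crs a z)
      have := mul_pos q.2.2 (by linarith : 0 < crs c z)
      linarith
    · have := t3 _ h1; have := t3 _ h2; rw [n, n] at this; linarith
  have hnegvol : volume (-U) = volume U := Measure.measure_neg volume U
  have htot : ENNReal.ofReal (crs b c + crs c a + crs a b) ≤ volume C := by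
    calc ENNReal.ofReal (crs b c + crs c a + crs a b)
        = ENNReal.ofReal ((crs b c + crs c a + crs a b) / 2)
          + ENNReal.ofReal ((crs b c + crs c a + crs a b) / 2) := by
          rw [← ENNReal.ofReal_add (by positivity) (by positivity)]; congr 1; ring
      _ ≤ volume U + volume (-U) := by rw [hnegvol]; gcongr
      _ = volume (U ∪ -U) := (measure_union hdisj hUo.neg.measurableSet).symm
      _ ≤ volume C := measure_mono (Set.union_subset hUC hUC')
  exact (ENNReal.ofReal_le_iff_le_toReal hfin).1 htot

lemma core_arith_pos (X Y Z r : ℝ) (hX : 0 ≤ X) (hY : 0 ≤ Y) (hZ : 0 ≤ Z) (h1 : X ≤ Y + Z)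
    (h2 : Y ≤ X + Z) (h3 : Z ≤ X + Y) (hS : 0 < X + Y + Z) (hr : r < 1)
    (m k : ℤ) (hm : 0 ≤ m) (hmk : m ≠ 0 ∨ k ≠ 0) (hm0 : m = 0 → 0 ≤ k)
    (e1 : |2 * m * Y + k * (Z - X + Y)| ≤ 2 * Y * r)
    (e2 : |2 * k * X + m * (X + Z - Y)| ≤ 2 * X * r)
    (e3 : |(k - m) * Z - (m + k) * (X - Y)| ≤ 2 * Z * r) : False := by
  have cast1 : ∀ n : ℤ, 1 ≤ n → (1 : ℝ) ≤ n := fun n hn => by exact_mod_cast hn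
  have cast0 : ∀ n : ℤ, 0 ≤ n → (0 : ℝ) ≤ n := fun n hn => by exact_mod_cast hn
  have cast2 : ∀ n : ℤ, n ≤ -1 → (n : ℝ) ≤ -1 := fun n hn => by exact_mod_cast hn
  have a1 := (abs_le.1 e1).2
  have a2 := (abs_le.1 e2).2
  have a3 := (abs_le.1 e3).1
  have hm' := cast0 m hm
  rcases lt_or_ge k 0 with hk | hk
  · have hm1 : 1 ≤ m := by
      by_contra h
      have : m = 0 := by omega
      have := hm0 this
      omega
    have hm1' := cast1 m hm1
    have hk' := cast2 k (by omega)
    rcases hZ.eq_or_lt with hz | hz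
    · have hXY : X = Y := by linarith
      have hYp : 0 < Y := by linarith
      rw [← hz, hXY] at a1
      nlinarith
    · nlinarith [mul_nonneg (by linarith : (0:ℝ) ≤ m - 1) (by linarith : 0 ≤ Z + X - Y),
        mul_nonneg (by linarith : (0:ℝ) ≤ -k - 1) (by linarith : 0 ≤ Z - X + Y)]
  · have hk' := cast0 k hk
    rcases hm.eq_or_lt with hm1 | hm1
    · have hk1 := cast1 k (by omega)
      rw [← hm1] at a1 a2
      push_cast at a1 a2
      rcases hX.eq_or_lt with hx | hx
      · have hYZ : Y = Z := by linarith
        rw [← hx, hYZ] at a1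
        nlinarith
      · nlinarith
    · have hm1' := cast1 m hm1
      rcases hY.eq_or_lt with hy | hy
      · have hXZ : X = Z := by linarith
        rw [← hy, hXZ] at a2
        nlinarith
      · nlinarith [mul_nonneg hk' (by linarith : 0 ≤ Z - X + Y)]

lemma core_arith (X Y Z r : ℝ) (hX : 0 ≤ X) (hY : 0 ≤ Y) (hZ : 0 ≤ Z) (h1 : X ≤ Y + Z)
    (h2 : Y ≤ X + Z) (h3 : Z ≤ X + Y) (hS : 0 < X + Y + Z) (hr : r < 1)
    (m k : ℤ) (hmk : m ≠ 0 ∨ k ≠ 0)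
    (e1 : |2 * m * Y + k * (Z - X + Y)| ≤ 2 * Y * r)
    (e2 : |2 * k * X + m * (X + Z - Y)| ≤ 2 * X * r)
    (e3 : |(k - m) * Z - (m + k) * (X - Y)| ≤ 2 * Z * r) : False := by
  by_cases h : 0 ≤ m ∧ (m = 0 → 0 ≤ k)
  · exact core_arith_pos X Y Z r hX hY hZ h1 h2 h3 hS hr m k h.1 hmk h.2 e1 e2 e3
  · refine core_arith_pos X Y Z r hX hY hZ h1 h2 h3 hS hr (-m) (-k) (by omega) (by omega)
      (by omega) ?_ ?_ ?_
    · rw [← abs_neg] at e1; convert e1 using 2; push_cast; ring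
    · rw [← abs_neg] at e2; convert e2 using 2; push_cast; ring
    · rw [← abs_neg] at e3; convert e3 using 2; push_cast; ring

lemma hull_bound (a b c : ℝ × ℝ) (k : ℝ × ℝ →L[ℝ] ℝ) (B : ℝ) (ha : |k a| ≤ B) (hb : |k b| ≤ B)
    (hc : |k c| ≤ B) (z : ℝ × ℝ)
    (hz : z ∈ convexHull ℝ ({a, b, c, -a, -b, -c} : Set (ℝ × ℝ))) : |k z| ≤ B := by
  have : convexHull ℝ ({a, b, c, -a, -b, -c} : Set (ℝ × ℝ)) ⊆ {z | |k z| ≤ B} := by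
    apply convexHull_min _ (strip_convex k B)
    intro w hw
    simp only [Set.mem_insert_iff, Set.mem_singleton_iff] at hw
    rcases hw with rfl | rfl | rfl | rfl | rfl | rfl <;>
      simpa only [Set.mem_ofPred_eq, map_neg, abs_neg]
  exact this hz

/-- The conclusion of the lower bound. -/
def Good (p : ℝ) (a b c : ℝ × ℝ) : Prop :=
  (∀ z : ℝ × ℝ, PP p z ≤ 1 → z ∈ convexHull ℝ ({a, b, c, -a, -b, -c} : Set (ℝ × ℝ))) →
    ∃ u v : ℝ × ℝ, IsAdmissible p u v ∧ 4 * covol u v ≤ (MeasureTheory.volume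
      (convexHull ℝ ({a, b, c, -a, -b, -c} : Set (ℝ × ℝ)))).toReal

lemma good_of_triangle (p : ℝ) (hp : 1 < p) (a b c : ℝ × ℝ) (hX : 0 ≤ crs b c) (hY : 0 ≤ crs c a)
    (hZ : 0 ≤ crs a b) (h1 : crs b c ≤ crs c a + crs a b) (h2 : crs c a ≤ crs b c + crs a b)
    (h3 : crs a b ≤ crs b c + crs c a) : Good p a b c := by
  intro hK
  have hp0 : p ≠ 0 := by linarith
  have hE1 : PP p ((1, 0) : ℝ × ℝ) ≤ 1 := by simp [PP, Real.zero_rpow hp0]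
  have hE2 : PP p ((0, 1) : ℝ × ℝ) ≤ 1 := by simp [PP, Real.zero_rpow hp0]
  have sw : ∀ z w : ℝ × ℝ, crs z w = - crs w z := by intro z w; simp [crs]; ring
  have sf : ∀ z : ℝ × ℝ, crs z z = 0 := by intro z; simp [crs]; ring
  have hS : 0 < crs b c + crs c a + crs a b := by
    by_contra hS
    have x0 : crs b c = 0 := by linarith
    have y0 : crs c a = 0 := by linarith
    have z0 : crs a b = 0 := by linarith
    have zero : ∀ w : ℝ × ℝ, crs w a = 0 → crs w b = 0 → crs w c = 0 → w = 0 := by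
      intro w wa wb wc
      have hb := hull_bound a b c (crsL w) 0 (by rw [crsL_apply, wa]; simp)
        (by rw [crsL_apply, wb]; simp) (by rw [crsL_apply, wc]; simp)
      have b1 := hb _ (hK _ hE1)
      have b2 := hb _ (hK _ hE2)
      rw [crsL_apply] at b1 b2
      simp [crs] at b1 b2
      exact Prod.ext b2 b1
    have a0 := zero a (sf a) z0 (by rw [sw, y0, neg_zero])
    have b0 := zero b (by rw [sw, z0, neg_zero]) (sf b) x0
    have c0 := zero c y0 (by rw [sw, x0, neg_zero]) (sf c)
    have := hull_bound a b c (ContinuousLinearMap.fst ℝ ℝ ℝ) 0 (by simp [a0]) (by simp [b0])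
      (by simp [c0]) _ (hK _ hE1)
    norm_num at this
  have hcov : covol ((1 / 2 : ℝ) • (a - c)) ((1 / 2 : ℝ) • (b - c))
      = (crs b c + crs c a + crs a b) / 4 := by
    have e : covol ((1 / 2 : ℝ) • (a - c)) ((1 / 2 : ℝ) • (b - c))
        = |(crs b c + crs c a + crs a b) / 4| := by
      unfold covol crs
      congr 1
      simp
      ring
    rw [e, abs_of_pos (by positivity)]
  refine ⟨(1 / 2 : ℝ) • (a - c), (1 / 2 : ℝ) • (b - c), ⟨?_, ?_⟩, ?_⟩
  · rw [hcov]; positivity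
  · rintro z ⟨m, k, rfl⟩ hz
    rw [← Int.cast_smul_eq_zsmul ℝ, ← Int.cast_smul_eq_zsmul ℝ] at *
    set z := (m : ℝ) • (1 / 2 : ℝ) • (a - c) + (k : ℝ) • (1 / 2 : ℝ) • (b - c) with hzdef
    by_contra hlt
    have hN : NN p z < 1 := by
      by_contra h
      push Not at h
      exact hlt ((one_le_NN p hp z).1 h)
    have hmk : m ≠ 0 ∨ k ≠ 0 := by
      by_contra h
      push Not at h
      apply hz
      rw [hzdef, h.1, h.2]; simp
    have g1 := abs_le_NN p hp (crsL (a + c)) (crs c a) (fun w hw => hull_bound a b c _ _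
      (by rw [crsL_apply, abs_le]; constructor <;> (unfold crs at *; simp; linarith))
      (by rw [crsL_apply, abs_le]; constructor <;> (unfold crs at *; simp; linarith))
      (by rw [crsL_apply, abs_le]; constructor <;> (unfold crs at *; simp; linarith)) w (hK w hw)) z
    have g2 := abs_le_NN p hp (crsL (b + c)) (crs b c) (fun w hw => hull_bound a b c _ _
      (by rw [crsL_apply, abs_le]; constructor <;> (unfold crs at *; simp; linarith))
      (by rw [crsL_apply, abs_le]; constructor <;> (unfold crs at *; simp; linarith))
      (by rw [crsL_apply, abs_le]; constructor <;> (unfold crs at *; simp; linarith)) w (hK w hw)) z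
    have g3 := abs_le_NN p hp (crsL (a + b)) (crs a b) (fun w hw => hull_bound a b c _ _
      (by rw [crsL_apply, abs_le]; constructor <;> (unfold crs at *; simp; linarith))
      (by rw [crsL_apply, abs_le]; constructor <;> (unfold crs at *; simp; linarith))
      (by rw [crsL_apply, abs_le]; constructor <;> (unfold crs at *; simp; linarith)) w (hK w hw)) z
    have dbl : ∀ x y B : ℝ, |x| ≤ B * NN p z → y = 2 * x → |y| ≤ 2 * B * NN p z := by
      intro x y B hx hy
      rw [hy, abs_mul, abs_two]; linarith
    refine core_arith (crs b c) (crs c a) (crs a b) (NN p z) hX hY hZ h1 h2 h3 hS hN m k hmk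
      (dbl _ _ _ g1 ?_) ?_ (dbl _ _ _ g3 ?_)
    · rw [crsL_apply, hzdef]; simp [crs]; ring
    · rw [← abs_neg]
      refine dbl _ _ _ g2 ?_
      rw [crsL_apply, hzdef]; simp [crs]; ring
    · rw [crsL_apply, hzdef]; simp [crs]; ring
  · rw [hcov]
    have := hull_volume_ge a b c hX hY hZ
    linarith

lemma good_of_big (p : ℝ) (hp : 1 < p) (a b c : ℝ × ℝ) (hX : 0 ≤ crs b c) (hY : 0 ≤ crs c a)
    (h3 : crs b c + crs c a < crs a b) : Good p a b c := by
  intro hK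
  have hZ : 0 < crs a b := by linarith
  have hg : Good p a b (-a) := by
    have x' : crs b (-a) = crs a b := by simp [crs]; ring
    have y' : crs (-a) a = 0 := by simp [crs]; ring
    apply good_of_triangle p hp <;> linarith
  set C' := convexHull ℝ ({a, b, -a, -a, -b, -(-a)} : Set (ℝ × ℝ)) with hC'
  set C := convexHull ℝ ({a, b, c, -a, -b, -c} : Set (ℝ × ℝ)) with hC
  have hCc : Convex ℝ C' := convex_convexHull _ _
  have hsub := subset_convexHull ℝ ({a, b, -a, -a, -b, -(-a)} : Set (ℝ × ℝ))
  have ma : a ∈ C' := hsub (by simp)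
  have mb : b ∈ C' := hsub (by simp)
  have ma' : -a ∈ C' := hsub (by simp)
  have mb' : -b ∈ C' := hsub (by simp)
  have m0 : (0 : ℝ × ℝ) ∈ C' := by
    have := hCc ma ma' (by norm_num : (0:ℝ) ≤ 1/2) (by norm_num : (0:ℝ) ≤ 1/2) (by norm_num)
    simpa using this
  have ec : -c = (crs b c / crs a b) • a + (crs c a / crs a b) • b := by
    ext
    · simp only [Prod.fst_add, Prod.smul_fst, smul_eq_mul, Prod.fst_neg]
      rw [div_mul_eq_mul_div, div_mul_eq_mul_div, ← add_div, eq_div_iff hZ.ne']; unfold crs; ring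
    · simp only [Prod.snd_add, Prod.smul_snd, smul_eq_mul, Prod.snd_neg]
      rw [div_mul_eq_mul_div, div_mul_eq_mul_div, ← add_div, eq_div_iff hZ.ne']; unfold crs; ring
  have ec' : c = (crs b c / crs a b) • (-a) + (crs c a / crs a b) • (-b) := by
    calc c = -(-c) := (neg_neg c).symm
      _ = -((crs b c / crs a b) • a + (crs c a / crs a b) • b) := congrArg Neg.neg ec
      _ = _ := by module
  have hsum : crs b c / crs a b + crs c a / crs a b ≤ 1 := by
    rw [← add_div, div_le_one hZ]; exact h3.le
  have mc' : -c ∈ C' := by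
    rw [ec]
    exact hull_tri C' hCc a b ma mb m0 _ _ (by positivity) (by positivity) hsum
  have mc : c ∈ C' := by
    rw [ec']
    exact hull_tri C' hCc _ _ ma' mb' m0 _ _ (by positivity) (by positivity) hsum
  have hCC' : C ⊆ C' := by
    apply convexHull_min _ hCc
    intro w hw
    simp only [Set.mem_insert_iff, Set.mem_singleton_iff] at hw
    rcases hw with rfl | rfl | rfl | rfl | rfl | rfl <;> assumption
  have hC'C : C' ⊆ C := by
    apply convexHull_mono
    intro w hw
    simp only [Set.mem_insert_iff, Set.mem_singleton_iff, neg_neg] at hw ⊢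
    tauto
  obtain ⟨u, v, h1, h2⟩ := hg (fun z hz => hCC' (hK z hz))
  refine ⟨u, v, h1, h2.trans ?_⟩
  have : C' = C := Set.Subset.antisymm hC'C hCC'
  rw [← hC', this]

lemma good_congr (p : ℝ) (a b c a' b' c' : ℝ × ℝ)
    (h : ({a, b, c, -a, -b, -c} : Set (ℝ × ℝ)) = {a', b', c', -a', -b', -c'})
    (hg : Good p a' b' c') : Good p a b c := by
  unfold Good at *
  rwa [h]

lemma good_of_nonneg (p : ℝ) (hp : 1 < p) (a b c : ℝ × ℝ) (hX : 0 ≤ crs b c) (hY : 0 ≤ crs c a)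
    (hZ : 0 ≤ crs a b) : Good p a b c := by
  rcases lt_or_ge (crs b c + crs c a) (crs a b) with h3 | h3
  · exact good_of_big p hp a b c hX hY h3
  rcases lt_or_ge (crs c a + crs a b) (crs b c) with h1 | h1
  · apply good_congr p a b c b c a _ (good_of_big p hp b c a hY hZ h1)
    ext; simp only [Set.mem_insert_iff, Set.mem_singleton_iff]; tauto
  rcases lt_or_ge (crs a b + crs b c) (crs c a) with h2 | h2
  · apply good_congr p a b c c a b _ (good_of_big p hp c a b hZ hX h2)
    ext; simp only [Set.mem_insert_iff, Set.mem_singleton_iff]; tauto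
  exact good_of_triangle p hp a b c hX hY hZ h1 (by linarith) h3

lemma good_all (p : ℝ) (hp : 1 < p) (a b c : ℝ × ℝ) : Good p a b c := by
  have sw : ∀ z w : ℝ × ℝ, crs z w = - crs w z := by intro z w; simp [crs]; ring
  have n1 : ∀ z w : ℝ × ℝ, crs (-z) w = - crs z w := by intro z w; simp [crs]; ring
  have n2 : ∀ z w : ℝ × ℝ, crs z (-w) = - crs z w := by intro z w; simp [crs]; ring
  have x := sw c b
  have y := sw a c
  have z := sw b a
  rcases le_total 0 (crs b c) with hX | hX <;> rcases le_total 0 (crs c a) with hY | hY <;>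
    rcases le_total 0 (crs a b) with hZ | hZ
  · exact good_of_nonneg p hp a b c hX hY hZ
  · refine good_congr p a b c a (-c) b ?_ (good_of_nonneg p hp _ _ _ ?_ ?_ ?_)
    · ext; simp only [Set.mem_insert_iff, Set.mem_singleton_iff, neg_neg]; tauto
    all_goals ((try simp only [n1, n2]); linarith)
  · refine good_congr p a b c a c (-b) ?_ (good_of_nonneg p hp _ _ _ ?_ ?_ ?_)
    · ext; simp only [Set.mem_insert_iff, Set.mem_singleton_iff, neg_neg]; tauto
    all_goals ((try simp only [n1, n2]); linarith)
  · refine good_congr p a b c (-a) b c ?_ (good_of_nonneg p hp _ _ _ ?_ ?_ ?_)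
    · ext; simp only [Set.mem_insert_iff, Set.mem_singleton_iff, neg_neg]; tauto
    all_goals ((try simp only [n1, n2]); linarith)
  · refine good_congr p a b c (-a) c b ?_ (good_of_nonneg p hp _ _ _ ?_ ?_ ?_)
    · ext; simp only [Set.mem_insert_iff, Set.mem_singleton_iff, neg_neg]; tauto
    all_goals ((try simp only [n1, n2]); linarith)
  · refine good_congr p a b c a (-b) c ?_ (good_of_nonneg p hp _ _ _ ?_ ?_ ?_)
    · ext; simp only [Set.mem_insert_iff, Set.mem_singleton_iff, neg_neg]; tauto
    all_goals ((try simp only [n1, n2]); linarith)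
  · refine good_congr p a b c a b (-c) ?_ (good_of_nonneg p hp _ _ _ ?_ ?_ ?_)
    · ext; simp only [Set.mem_insert_iff, Set.mem_singleton_iff, neg_neg]; tauto
    all_goals ((try simp only [n1, n2]); linarith)
  · refine good_congr p a b c a c b ?_ (good_of_nonneg p hp _ _ _ ?_ ?_ ?_)
    · ext; simp only [Set.mem_insert_iff, Set.mem_singleton_iff]; tauto
    all_goals linarith

lemma standard_admissible (p : ℝ) (hp : 1 < p) : IsAdmissible p (1, 0) (0, 1) := by
  refine ⟨by simp [covol], ?_⟩
  rintro z ⟨m, k, rfl⟩ hz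
  have hp0 : 0 ≤ p := by linarith
  have one : ∀ n : ℤ, n ≠ 0 → 1 ≤ |(n : ℝ)| ^ p := by
    intro n hn
    apply Real.one_le_rpow _ hp0
    exact_mod_cast Int.one_le_abs hn
  have e1 : (m • ((1, 0) : ℝ × ℝ) + k • ((0, 1) : ℝ × ℝ)).1 = m := by simp
  have e2 : (m • ((1, 0) : ℝ × ℝ) + k • ((0, 1) : ℝ × ℝ)).2 = k := by simp
  rw [e1, e2]
  have p1 : 0 ≤ |(m : ℝ)| ^ p := by positivity
  have p2 : 0 ≤ |(k : ℝ)| ^ p := by positivity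
  by_cases hm : m = 0
  · have hk : k ≠ 0 := by
      intro hk; apply hz; rw [hm, hk]; simp
    have := one k hk
    linarith
  · have := one m hm
    linarith

lemma hexSet_sInf (p : ℝ) (hp : 1 < p) : sInf (hexSet p) = 4 * criticalDet p := by
  have hbd : BddBelow (hexSet p) := by
    refine ⟨0, ?_⟩
    rintro A ⟨a, b, c, -, -, rfl⟩
    exact ENNReal.toReal_nonneg
  have hbd' : BddBelow {d : ℝ | ∃ u v : ℝ × ℝ, IsAdmissible p u v ∧ d = covol u v} := by
    refine ⟨0, ?_⟩
    rintro d ⟨u, v, -, rfl⟩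
    exact abs_nonneg _
  have hex : ∀ u v, IsAdmissible p u v → ∃ A ∈ hexSet p, A ≤ 4 * covol u v := by
    intro u v h
    obtain ⟨x, y, hx, hy, hxy, hD, hle⟩ := exists_inscribed p hp u v h
    obtain ⟨A, hA, hA'⟩ := exists_hex p hp x y hx hy hxy hD
    exact ⟨A, hA, hA'.trans (by linarith)⟩
  apply le_antisymm
  · have : sInf (hexSet p) / 4 ≤ criticalDet p := by
      refine le_csInf (s := {d : ℝ | ∃ u v : ℝ × ℝ, IsAdmissible p u v ∧ d = covol u v})
        ⟨covol (1, 0) (0, 1), (1, 0), (0, 1), standard_admissible p hp, rfl⟩ ?_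
      rintro d ⟨u, v, h, rfl⟩
      obtain ⟨A, hA, hA'⟩ := hex u v h
      have := csInf_le hbd hA
      linarith
    linarith
  · apply le_csInf
    · obtain ⟨A, hA, -⟩ := hex _ _ (standard_admissible p hp)
      exact ⟨A, hA⟩
    · rintro A ⟨a, b, c, hK, -, rfl⟩
      obtain ⟨u, v, h, hle⟩ := good_all p hp a b c hK
      have : criticalDet p ≤ covol u v := csInf_le hbd' ⟨u, v, h, rfl⟩
      linarith


/-- For real `p > 1`, the infimum of the areas of centrally
symmetric hexagons `H = conv{±a, ±b, ±c}` containing the closed Minkowski ball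
`{(x,y) | |x|ᵖ + |y|ᵖ ≤ 1}` and whose boundary meets the curve
`|x|ᵖ + |y|ᵖ = 1` in three pairs of points `±q₁, ±q₂, ±q₃`, equals `4·Δ(D_p)`. -/
theorem statement_9 (p : ℝ) (hp : 1 < p) :
    sInf {A : ℝ | ∃ a b c : ℝ × ℝ,
        (∀ z : ℝ × ℝ, |z.1| ^ p + |z.2| ^ p ≤ 1 →
            z ∈ convexHull ℝ ({a, b, c, -a, -b, -c} : Set (ℝ × ℝ))) ∧
        (∃ q₁ q₂ q₃ : ℝ × ℝ,
            ({q₁, q₂, q₃, -q₁, -q₂, -q₃} : Set (ℝ × ℝ)).ncard = 6 ∧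
            ∀ q ∈ ({q₁, q₂, q₃, -q₁, -q₂, -q₃} : Set (ℝ × ℝ)),
              q ∈ frontier (convexHull ℝ ({a, b, c, -a, -b, -c} : Set (ℝ × ℝ))) ∧
              |q.1| ^ p + |q.2| ^ p = 1) ∧
        A = (MeasureTheory.volume
            (convexHull ℝ ({a, b, c, -a, -b, -c} : Set (ℝ × ℝ)))).toReal}
      = 4 * criticalDet p := by
  exact hexSet_sInf p hp

end
end
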